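/- There exists a constant c > 0 such that for every connected vertex-transitive graph G on n ≥ 3 vertices, any two longest cycles X and Y of G satisfy |V(X) ∩ V(Y)| ≥ c·(ln n / ln ln n)^(1/3). -/

import Mathlib

open SimpleGraph

/-- `X` is a longest cycle in `G`. -/
def IsLongestCycle {V : Type*} (G : SimpleGraph V) {x : V} (X : G.Walk x x) : Prop :=
  X.IsCycle ∧ ∀ (y : V) (W : G.Walk y y), W.IsCycle → W.length ≤ X.length

/-- `G` is vertex-transitive: any vertex can be mapped to any other by an automorphism. -/
def IsVertexTransitive {V : Type*} (G : SimpleGraph V) : Prop :=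
  ∀ u v : V, ∃ g : G ≃g G, g u = v


/-- trimming a walk between two sets -/
theorem trim_walk {V : Type} [DecidableEq V] (H : SimpleGraph V) (A B : Set V) {a b : V} (ha : a ∈ A) (hb : b ∈ B)
    (p : H.Walk a b) : ∃ a' ∈ A, ∃ b' ∈ B, ∃ q : H.Walk a' b', q.IsPath ∧ (∀ v ∈ q.support, v ∈ p.support) ∧
      (∀ v ∈ q.support, v ∈ A → v = a') ∧ (∀ v ∈ q.support, v ∈ B → v = b') := by
  classical
  let Q : ℕ → Prop := fun n => ∃ a' ∈ A, ∃ b' ∈ B, ∃ q : H.Walk a' b', q.length = n ∧ ∀ v ∈ q.support, v ∈ p.support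
  have hQ : ∃ n, Q n := ⟨_, a, ha, b, hb, p, rfl, fun _ h => h⟩
  obtain ⟨a', ha', b', hb', q, hq, hs⟩ := Nat.find_spec hQ
  have hmin : ∀ n, Q n → q.length ≤ n := fun n hn => hq ▸ Nat.find_min' hQ hn
  refine ⟨a', ha', b', hb', q, ?_, hs, ?_, ?_⟩
  · have h1 := hmin _ ⟨a', ha', b', hb', q.bypass, rfl, fun v hv => hs v (q.support_bypass_subset_support hv)⟩
    have : q.bypass = q := Walk.bypass_eq_self_of_length_le_length_bypass _ h1
    rw [← this]; exact q.bypass_isPath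
  · intro v hv hvA
    have h1 := hmin _ ⟨v, hvA, b', hb', q.dropUntil v hv, rfl, fun u hu => hs u (q.support_dropUntil_subset_support hv hu)⟩
    have h2 := congrArg Walk.length (q.take_spec hv)
    rw [Walk.length_append] at h2
    have : (q.takeUntil v hv).length = 0 := by omega
    exact (Walk.eq_of_length_eq_zero this).symm
  · intro v hv hvA
    have h1 := hmin _ ⟨a', ha', v, hvA, q.takeUntil v hv, rfl, fun u hu => hs u (q.support_takeUntil_subset_support hv hu)⟩
    have h2 := congrArg Walk.length (q.take_spec hv)
    rw [Walk.length_append] at h2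
    have : (q.dropUntil v hv).length = 0 := by omega
    exact (Walk.eq_of_length_eq_zero this)

/-- first use of an edge -/
theorem first_use {V : Type} (H : SimpleGraph V) (x y : V) {a b : V} (p : H.Walk a b) :
    (∃ q : (H.deleteEdges {s(x, y)}).Walk a b, ∀ v ∈ q.support, v ∈ p.support) ∨
    (∃ q : (H.deleteEdges {s(x, y)}).Walk a x, ∀ v ∈ q.support, v ∈ p.support) ∨
    (∃ q : (H.deleteEdges {s(x, y)}).Walk a y, ∀ v ∈ q.support, v ∈ p.support) := by
  induction p with
  | nil => exact Or.inl ⟨Walk.nil, by simp⟩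
  | @cons u v w h p ih =>
    by_cases he : s(u, v) = s(x, y)
    · rw [Sym2.eq_iff] at he
      rcases he with ⟨rfl, rfl⟩ | ⟨rfl, rfl⟩
      · exact Or.inr (Or.inl ⟨Walk.nil, by simp⟩)
      · exact Or.inr (Or.inr ⟨Walk.nil, by simp⟩)
    · have h' : (H.deleteEdges {s(x, y)}).Adj u v := by
        rw [deleteEdges_adj]; exact ⟨h, by simpa using he⟩
      rcases ih with ⟨q, hq⟩ | ⟨q, hq⟩ | ⟨q, hq⟩
      · refine Or.inl ⟨Walk.cons h' q, ?_⟩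
        intro z hz; simp only [Walk.support_cons, List.mem_cons] at hz ⊢
        exact hz.imp id (hq z)
      · refine Or.inr (Or.inl ⟨Walk.cons h' q, ?_⟩)
        intro z hz; simp only [Walk.support_cons, List.mem_cons] at hz ⊢
        exact hz.imp id (hq z)
      · refine Or.inr (Or.inr ⟨Walk.cons h' q, ?_⟩)
        intro z hz; simp only [Walk.support_cons, List.mem_cons] at hz ⊢
        exact hz.imp id (hq z)

/-- there is no single separating vertex -/
def NoSep {V : Type} (H : SimpleGraph V) (A B : Set V) : Prop :=
  ∀ z, ∃ a ∈ A, ∃ b ∈ B, ∃ p : H.Walk a b, z ∉ p.support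

/-- two disjoint walks -/
def TwoDisj {V : Type} (H : SimpleGraph V) (A B : Set V) : Prop :=
  ∃ a ∈ A, ∃ b ∈ A, ∃ c ∈ B, ∃ d ∈ B, ∃ P : H.Walk a c, ∃ Q : H.Walk b d, ∀ v ∈ P.support, v ∉ Q.support

theorem NoSep.symm {V : Type} {H : SimpleGraph V} {A B : Set V} (h : NoSep H A B) : NoSep H B A := by
  intro z
  obtain ⟨a, ha, b, hb, p, hp⟩ := h z
  exact ⟨b, hb, a, ha, p.reverse, by simpa using hp⟩

theorem noSep_aux {V : Type} [DecidableEq V] {H : SimpleGraph V} {A B : Set V} (h : NoSep H A B) (x y s : V)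
    (hs : ∀ a ∈ A, ∀ b ∈ B, ∀ p : (H.deleteEdges {s(x, y)}).Walk a b, s ∈ p.support)
    (hy : ∃ b ∈ B, ∃ p : (H.deleteEdges {s(x, y)}).Walk y b, s ∉ p.support) :
    NoSep (H.deleteEdges {s(x, y)}) A {s, x} := by
  intro z
  obtain ⟨a, ha, b, hb, p, hp⟩ := h z
  rcases first_use H x y p with ⟨q, hq⟩ | ⟨q, hq⟩ | ⟨q, hq⟩
  · have := hs a ha b hb q
    exact ⟨a, ha, s, by simp, q.takeUntil s this, fun h => hp (hq _ (q.support_takeUntil_subset_support this h))⟩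
  · exact ⟨a, ha, x, by simp, q, fun h => hp (hq _ h)⟩
  · by_cases hsq : s ∈ q.support
    · exact ⟨a, ha, s, by simp, q.takeUntil s hsq, fun h => hp (hq _ (q.support_takeUntil_subset_support hsq h))⟩
    · obtain ⟨b', hb', p', hp'⟩ := hy
      exact absurd (hs a ha b' hb' (q.append p')) (by simp [Walk.mem_support_append_iff, hsq, hp'])

theorem two_to_pair {V : Type} [DecidableEq V] {H : SimpleGraph V} {A : Set V} {s x : V}
    (h : TwoDisj H A {s, x}) : ∃ a ∈ A, ∃ b ∈ A, ∃ P : H.Walk a s, ∃ Q : H.Walk b x,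
      (∀ v ∈ P.support, v ∉ Q.support) ∧ P.IsPath := by
  obtain ⟨a, ha, b, hb, c, hc, d, hd, P, Q, hPQ⟩ := h
  have hcd : c ≠ d := fun h => hPQ c P.end_mem_support (h ▸ Q.end_mem_support)
  simp only [Set.mem_insert_iff, Set.mem_singleton_iff] at hc hd
  rcases hc with rfl | rfl <;> rcases hd with rfl | rfl
  · exact absurd rfl hcd
  · exact ⟨a, ha, b, hb, P.bypass, Q, fun v hv => hPQ v (P.support_bypass_subset_support hv), P.bypass_isPath⟩
  · exact ⟨b, hb, a, ha, Q.bypass, P, fun v hv hv' => hPQ v hv' (Q.support_bypass_subset_support hv), Q.bypass_isPath⟩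
  · exact absurd rfl hcd

theorem path_avoid {V : Type} [DecidableEq V] {H : SimpleGraph V} {a s v : V} (P : H.Walk a s) (hP : P.IsPath)
    (hv : v ∈ P.support) (hne : v ≠ s) : ∃ q : H.Walk a v, s ∉ q.support := by
  refine ⟨P.takeUntil v hv, ?_⟩
  exact Walk.endpoint_notMem_support_takeUntil hP hv hne.symm

theorem menger_combine {V : Type} [DecidableEq V] {H : SimpleGraph V} {A B : Set V} (x y s : V)
    (hxy : H.Adj x y)
    (hs : ∀ a ∈ A, ∀ b ∈ B, ∀ p : (H.deleteEdges {s(x, y)}).Walk a b, s ∈ p.support)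
    (h1 : TwoDisj (H.deleteEdges {s(x, y)}) A {s, x})
    (h2 : TwoDisj (H.deleteEdges {s(x, y)}) B {s, y}) : TwoDisj H A B := by
  obtain ⟨a, ha, b, hb, P1, P2, hP, hP1⟩ := two_to_pair h1
  obtain ⟨c, hc, d, hd, Q1, Q2, hQ, hQ1⟩ := two_to_pair h2
  have key : ∀ {u v z : V} (hu : u ∈ A) (hv : v ∈ B) (p : (H.deleteEdges {s(x, y)}).Walk u z) 
      (q : (H.deleteEdges {s(x, y)}).Walk v z), s ∉ p.support → s ∉ q.support → False := by
    intro u v z hu hv p q hp hq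
    have := hs u hu v hv (p.append q.reverse)
    simp [Walk.mem_support_append_iff, hp, hq] at this
  have hsP2 := hP s P1.end_mem_support
  have hsQ2 := hQ s Q1.end_mem_support
  have sub : ∀ {u v : V} (p : (H.deleteEdges {s(x, y)}).Walk u v) (z : V) (hz : z ∈ p.support), s ∉ p.support → 
      ∃ q : (H.deleteEdges {s(x, y)}).Walk u z, s ∉ q.support := by
    intro u v p z hz h
    exact ⟨p.takeUntil z hz, fun h' => h (p.support_takeUntil_subset_support hz h')⟩
  have hle := deleteEdges_le (G := H) {s(x, y)}
  refine ⟨a, ha, b, hb, c, hc, d, hd, ((P1.append Q1.reverse).mapLe hle), 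
    ((P2.mapLe hle).append (Walk.cons hxy (Q2.reverse.mapLe hle))), ?_⟩
  intro v hv
  simp only [Walk.support_mapLe_eq_support, Walk.mem_support_append_iff, Walk.support_reverse, List.mem_reverse,
    Walk.support_cons, List.mem_cons] at hv ⊢
  have e1 : ∀ v, v ∈ P1.support → v ∉ Q2.support := by
    intro v hv hv2
    have hne : v ≠ s := fun h => hsQ2 (h ▸ hv2)
    obtain ⟨p, hp⟩ := path_avoid P1 hP1 hv hne
    obtain ⟨q, hq⟩ := sub Q2 v hv2 hsQ2
    exact key ha hd p q hp hq
  have e2 : ∀ v, v ∈ Q1.support → v ∉ P2.support := by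
    intro v hv hv2
    have hne : v ≠ s := fun h => hsP2 (h ▸ hv2)
    obtain ⟨p, hp⟩ := path_avoid Q1 hQ1 hv hne
    obtain ⟨q, hq⟩ := sub P2 v hv2 hsP2
    exact key hb hc q p hq hp
  rintro (h | h | h)
  · rcases hv with hv | hv
    · exact hP v hv h
    · exact e2 v hv h
  · subst h
    rcases hv with hv | hv
    · exact hP v hv P2.end_mem_support
    · exact e2 v hv P2.end_mem_support
  · rcases hv with hv | hv
    · exact e1 v hv h
    · exact hQ v hv h

theorem menger2 {V : Type} [Fintype V] [Nonempty V] [DecidableEq V] (m : ℕ) : ∀ (H : SimpleGraph V), H.edgeSet.ncard ≤ m → ∀ A B : Set V, NoSep H A B →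
    TwoDisj H A B := by
  induction m with
  | zero =>
    intro H hH A B h
    have hE : H.edgeSet = ∅ := by
      rw [← Set.ncard_eq_zero (Set.toFinite _)]; omega
    have hb : H = ⊥ := by simpa using hE
    subst hb
    have tr : ∀ {a b : V} (p : (⊥ : SimpleGraph V).Walk a b), a = b := by
      intro a b p
      cases p with
      | nil => rfl
      | cons h _ => exact absurd h (by simp)
    obtain ⟨a, ha, b, hb, p, hp⟩ := h (Classical.arbitrary V)
    obtain rfl := tr p
    obtain ⟨c, hc, d, hd, q, hq⟩ := h a
    obtain rfl := tr q
    refine ⟨a, ha, c, hc, a, hb, c, hd, Walk.nil, Walk.nil, ?_⟩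
    intro v hv hv'
    simp at hv hv'
    subst hv; subst hv'
    exact hq (Walk.start_mem_support _)
  | succ m ih =>
    intro H hH A B h
    by_cases hm : H.edgeSet.ncard ≤ m
    · exact ih H hm A B h
    obtain ⟨e, he⟩ : H.edgeSet.Nonempty := by
      rw [← Set.ncard_pos (Set.toFinite _)]; omega
    induction e with | _ x y =>
    have hxy : H.Adj x y := he
    have hcard : (H.deleteEdges {s(x, y)}).edgeSet.ncard ≤ m := by
      rw [edgeSet_deleteEdges, Set.ncard_sdiff_singleton_of_mem he]; omega
    by_cases hns : NoSep (H.deleteEdges {s(x, y)}) A B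
    · obtain ⟨a, ha, b, hb, c, hc, d, hd, P, Q, hPQ⟩ := ih _ hcard A B hns
      exact ⟨a, ha, b, hb, c, hc, d, hd, P.mapLe (deleteEdges_le _), Q.mapLe (deleteEdges_le _), by simpa using hPQ⟩
    unfold NoSep at hns
    push Not at hns
    obtain ⟨s, hs⟩ := hns
    obtain ⟨a, ha, b, hb, p, hp⟩ := h s
    have hsym : s(y, x) = s(x, y) := Sym2.eq_swap
    have f1 := first_use H x y p
    have f2 := first_use H x y p.reverse
    have n1 : ¬ ∃ q : (H.deleteEdges {s(x, y)}).Walk a b, ∀ v ∈ q.support, v ∈ p.support := by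
      rintro ⟨q, hq⟩
      exact hp (hq _ (hs a ha b hb q))
    have n2 : ¬ ∃ q : (H.deleteEdges {s(x, y)}).Walk b a, ∀ v ∈ q.support, v ∈ p.reverse.support := by
      rintro ⟨q, hq⟩
      have h1 := hs a ha b hb q.reverse
      exact hp (by simpa using hq s (by simpa using h1))
    have hs' : ∀ b ∈ B, ∀ a ∈ A, ∀ p : (H.deleteEdges {s(x, y)}).Walk b a, s ∈ p.support := by
      intro b hb a ha p
      simpa using hs a ha b hb p.reverse
    have key : ∀ z, ∀ q : (H.deleteEdges {s(x, y)}).Walk a z, ∀ q' : (H.deleteEdges {s(x, y)}).Walk b z,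
        (∀ v ∈ q.support, v ∈ p.support) → (∀ v ∈ q'.support, v ∈ p.reverse.support) → False := by
      intro z q q' hq hq'
      have := hs a ha b hb (q.append q'.reverse)
      rw [Walk.mem_support_append_iff] at this
      rcases this with h | h
      · exact hp (hq _ h)
      · exact hp (by simpa using hq' s (by simpa using h))
    rcases f1.resolve_left n1 with ⟨q, hq⟩ | ⟨q, hq⟩ <;> rcases f2.resolve_left n2 with ⟨q', hq'⟩ | ⟨q', hq'⟩
    · exact (key _ q q' hq hq').elim
    · have g1 := noSep_aux h x y s hs ⟨b, hb, q'.reverse, fun h => hp (by simpa using hq' s (by simpa using h))⟩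
      have g2 := noSep_aux (B := A) (A := B) h.symm y x s (by rw [hsym]; exact hs') 
        (by rw [hsym]; exact ⟨a, ha, q.reverse, fun h => hp (hq s (by simpa using h))⟩)
      rw [hsym] at g2
      exact menger_combine x y s hxy hs (ih _ hcard _ _ g1) (ih _ hcard _ _ g2)
    · have g1 := noSep_aux h y x s (by rw [hsym]; exact hs) 
        (by rw [hsym]; exact ⟨b, hb, q'.reverse, fun h => hp (by simpa using hq' s (by simpa using h))⟩)
      have g2 := noSep_aux (B := A) (A := B) h.symm x y s hs' ⟨a, ha, q.reverse, fun h => hp (hq s (by simpa using h))⟩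
      have h1 := ih _ (by rw [hsym]; exact hcard) _ _ g1
      have h2 := ih _ hcard _ _ g2
      exact menger_combine y x s hxy.symm (by rw [hsym]; exact hs) h1 (by rw [hsym]; exact h2)
    · exact (key _ q q' hq hq').elim


theorem append_path {V : Type} {G : SimpleGraph V} {a b c : V} {p : G.Walk a b} {q : G.Walk b c}
    (hp : p.IsPath) (hq : q.IsPath) (h : ∀ v ∈ p.support, v ∈ q.support → v = b) : (p.append q).IsPath := by
  rw [Walk.isPath_def, Walk.support_append, List.nodup_append']
  refine ⟨hp.support_nodup, hq.support_nodup.tail, ?_⟩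
  intro v hv hv'
  have hvb := h v hv (List.mem_of_mem_tail hv')
  subst hvb
  have := hq.support_nodup
  rw [← Walk.cons_tail_support, List.nodup_cons] at this
  exact this.1 hv'

theorem append_cycle {V : Type} {G : SimpleGraph V} {a b : V} {p : G.Walk a b} {q : G.Walk b a}
    (hp : p.IsPath) (hq : q.IsPath) (h : ∀ v ∈ p.support, v ∈ q.support → v = a ∨ v = b) 
    (hl : 1 < p.length) : (p.append q).IsCycle := by
  refine hp.isCycle_append hq ?_ (Or.inl hl)
  intro v hv hv'
  have h1 := hp.support_nodup
  have h2 := hq.support_nodup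
  rw [← Walk.cons_tail_support, List.nodup_cons] at h1 h2
  rcases h v (List.mem_of_mem_tail hv) (List.mem_of_mem_tail hv') with rfl | rfl
  · exact h1.1 hv
  · exact h2.1 hv'

theorem swap_cycle {V : Type} {G : SimpleGraph V} {a b c d : V} (SX SY : Set V)
    (β : G.Walk b a) (γ : G.Walk c d) (P : G.Walk a c) (Q : G.Walk b d)
    (hβ : β.IsPath) (hγ : γ.IsPath) (hP : P.IsPath) (hQ : Q.IsPath)
    (hPQ : ∀ v ∈ P.support, v ∉ Q.support)
    (hβX : ∀ v ∈ β.support, v ∈ SX) (hγY : ∀ v ∈ γ.support, v ∈ SY ∧ v ∉ SX)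
    (hPX : ∀ v ∈ P.support, v ∈ SX → v = a) (hPY : ∀ v ∈ P.support, v ∈ SY → v = c)
    (hQX : ∀ v ∈ Q.support, v ∈ SX → v = b) (hQY : ∀ v ∈ Q.support, v ∈ SY → v = d) :
    ∃ (z : V) (W : G.Walk z z), W.IsCycle ∧ W.length = β.length + P.length + γ.length + Q.length := by
  have hab : b ≠ a := fun h => hPQ a P.start_mem_support (h ▸ Q.start_mem_support)
  have hac : a ≠ c := fun h => (hγY c γ.start_mem_support).2 (h ▸ hβX a β.end_mem_support)
  have l1 : 0 < β.length := by
    rw [Nat.pos_iff_ne_zero]; exact fun h => hab (Walk.eq_of_length_eq_zero h)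
  have l2 : 0 < P.length := by
    rw [Nat.pos_iff_ne_zero]; exact fun h => hac (Walk.eq_of_length_eq_zero h)
  have e1 : (β.append P).IsPath := append_path hβ hP fun v hv hv' => hPX v hv' (hβX v hv)
  have e2 : ((β.append P).append γ).IsPath := by
    refine append_path e1 hγ fun v hv hv' => ?_
    rw [Walk.mem_support_append_iff] at hv
    rcases hv with hv | hv
    · exact absurd (hβX v hv) (hγY v hv').2
    · exact hPY v hv (hγY v hv').1
  refine ⟨b, ((β.append P).append γ).append Q.reverse, append_cycle e2 hQ.reverse ?_ ?_, ?_⟩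
  · intro v hv hv'
    simp only [Walk.mem_support_append_iff, Walk.support_reverse, List.mem_reverse] at hv hv'
    rcases hv with (hv | hv) | hv
    · exact Or.inl (hQX v hv' (hβX v hv))
    · exact absurd hv' (hPQ v hv)
    · exact Or.inr (hQY v hv' (hγY v hv).1)
  · simp only [Walk.length_append]; omega
  · simp only [Walk.length_append, Walk.length_reverse]

theorem arcs_idx {V : Type} {G : SimpleGraph V} {x : V} (X : G.Walk x x) (hX : X.IsCycle) {i j : ℕ}
    (hij : i < j) (hj : j < X.length) :
    ∃ (α : G.Walk (X.getVert i) (X.getVert j)) (β : G.Walk (X.getVert j) (X.getVert i)),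
      α.IsPath ∧ β.IsPath ∧ α.length + β.length = X.length ∧
      (∀ v ∈ α.support, ∃ l, i ≤ l ∧ l ≤ j ∧ X.getVert l = v) ∧ (∀ v ∈ β.support, v ∈ X.support) := by
  have hinj := hX.getVert_injOn'
  have pathd : ∀ m, 0 < m → (X.drop m).IsPath := by
    intro m hm
    have h := X.append_take_drop_eq m
    refine Walk.IsCycle.isPath_of_append_right (p := X.take m) ?_ (by rw [h]; exact hX)
    rw [← Walk.length_eq_zero_iff, Walk.take_length]; omega
  have patht : ∀ m, m < X.length → (X.take m).IsPath := by
    intro m hm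
    have h := X.append_take_drop_eq m
    refine Walk.IsCycle.isPath_of_append_left (q := X.drop m) ?_ (by rw [h]; exact hX)
    rw [← Walk.length_eq_zero_iff, Walk.drop_length]; omega
  have hα : ((X.drop i).take (j - i)).IsPath := by
    have h1 := patht (i + (j - i)) (by omega)
    rw [Walk.take_add_eq, Walk.isPath_copy] at h1
    exact h1.of_append_right
  have hij' : (X.drop i).getVert (j - i) = X.getVert j := by rw [Walk.drop_getVert]; congr 1; omega
  refine ⟨((X.drop i).take (j - i)).copy rfl hij', (X.drop j).append (X.take i), by simpa using hα, ?_, ?_, ?_, ?_⟩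
  · refine append_path (pathd j (by omega)) (patht i (by omega)) ?_
    intro v hv hv'
    rw [Walk.mem_support_iff_exists_getVert] at hv hv'
    obtain ⟨l, hl, hl2⟩ := hv
    obtain ⟨l', hl', hl2'⟩ := hv'
    rw [Walk.drop_getVert] at hl
    rw [Walk.take_getVert] at hl'
    rw [Walk.drop_length] at hl2
    by_cases hjl : j + l = X.length
    · rw [hjl, Walk.getVert_length] at hl; exact hl.symm
    · have := hinj (x₁ := j + l) (x₂ := i ⊓ l') (by simp; omega) (by simp; omega) (hl.trans hl'.symm)
      omega
  · simp [Walk.take_length, Walk.drop_length]; omega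
  · intro v hv
    rw [Walk.support_copy, Walk.mem_support_iff_exists_getVert] at hv
    obtain ⟨l, hl, hl2⟩ := hv
    rw [Walk.take_getVert, Walk.drop_getVert] at hl
    rw [Walk.take_length] at hl2
    exact ⟨_, by omega, by omega, hl⟩
  · intro v hv
    rw [Walk.mem_support_append_iff] at hv
    rw [← X.append_take_drop_eq j, Walk.mem_support_append_iff]
    rcases hv with hv | hv
    · exact Or.inr hv
    · left
      rw [Walk.mem_support_iff_exists_getVert] at hv ⊢
      obtain ⟨l, hl, hl2⟩ := hv
      rw [Walk.take_getVert] at hl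
      rw [Walk.take_length] at hl2
      refine ⟨l, ?_, ?_⟩
      · rw [Walk.take_getVert, ← hl]; congr 1; omega
      · rw [Walk.take_length]; omega

theorem arcs_lab {V : Type} [DecidableEq V] {G : SimpleGraph V} {x : V} (X : G.Walk x x) (hX : X.IsCycle)
    (S : Finset V) : ∃ lab : V → ℕ, (∀ v, lab v ≤ S.card) ∧ ∀ a b, a ∈ X.support → b ∈ X.support → 
      a ∉ S → b ∉ S → a ≠ b → lab a = lab b → 
      ∃ (α : G.Walk a b) (β : G.Walk b a), α.IsPath ∧ β.IsPath ∧ α.length + β.length = X.length ∧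
        (∀ v ∈ α.support, v ∈ X.support ∧ v ∉ S) ∧ (∀ v ∈ β.support, v ∈ X.support) := by
  classical
  have hinj := hX.getVert_injOn'
  have hL := hX.three_le_length
  have hex : ∀ v, ∃ i, v ∈ X.support → (i < X.length ∧ X.getVert i = v) := by
    intro v
    by_cases hv : v ∈ X.support
    · obtain ⟨i, hi, hi2⟩ := Walk.mem_support_iff_exists_getVert.1 hv
      by_cases h : i = X.length
      · refine ⟨0, fun _ => ⟨by omega, ?_⟩⟩
        subst h
        rw [Walk.getVert_zero, ← hi, Walk.getVert_length]
      · exact ⟨i, fun _ => ⟨by omega, hi⟩⟩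
    · exact ⟨0, fun h => absurd h hv⟩
  choose idx hidx using hex
  refine ⟨fun v => (S.filter fun s => ∃ l, l ≤ idx v ∧ X.getVert l = s).card, fun v => Finset.card_filter_le _ _, ?_⟩
  have main : ∀ a b, a ∈ X.support → b ∈ X.support → a ∉ S → b ∉ S → idx a < idx b → 
      (S.filter fun s => ∃ l, l ≤ idx a ∧ X.getVert l = s).card = (S.filter fun s => ∃ l, l ≤ idx b ∧ X.getVert l = s).card →
      ∃ (α : G.Walk a b) (β : G.Walk b a), α.IsPath ∧ β.IsPath ∧ α.length + β.length = X.length ∧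
        (∀ v ∈ α.support, v ∈ X.support ∧ v ∉ S) ∧ (∀ v ∈ β.support, v ∈ X.support) := by
    intro a b ha hb haS hbS hlt hc
    obtain ⟨ia, ea⟩ := hidx a ha
    obtain ⟨ib, eb⟩ := hidx b hb
    obtain ⟨α, β, h1, h2, h3, h4, h5⟩ := arcs_idx X hX hlt ib
    have heq := Finset.eq_of_subset_of_card_le (s := S.filter fun s => ∃ l, l ≤ idx a ∧ X.getVert l = s)
      (t := S.filter fun s => ∃ l, l ≤ idx b ∧ X.getVert l = s) (by
        intro s hs
        simp only [Finset.mem_filter] at hs ⊢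
        obtain ⟨hs, l, hl, e⟩ := hs
        exact ⟨hs, l, by omega, e⟩) hc.ge
    refine ⟨α.copy ea eb, β.copy eb ea, by simpa using h1, by simpa using h2, by simpa using h3, ?_, by simpa using h5⟩
    intro v hv
    rw [Walk.support_copy] at hv
    obtain ⟨l, hl1, hl2, e⟩ := h4 v hv
    refine ⟨e ▸ X.getVert_mem_support l, fun hvS => ?_⟩
    have : v ∈ S.filter fun s => ∃ l, l ≤ idx b ∧ X.getVert l = s := by
      simp only [Finset.mem_filter]; exact ⟨hvS, l, hl2, e⟩
    rw [← heq] at this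
    simp only [Finset.mem_filter] at this
    obtain ⟨_, l', hl', e'⟩ := this
    have := hinj (x₁ := l) (x₂ := l') (by simp; omega) (by simp; omega) (e.trans e'.symm)
    have : l = idx a := by omega
    subst this
    exact haS (ea ▸ e ▸ hvS)
  intro a b ha hb haS hbS hne hlab
  rcases lt_trichotomy (idx a) (idx b) with h | h | h
  · exact main a b ha hb haS hbS h hlab
  · exact absurd ((hidx a ha).2.symm.trans (h ▸ (hidx b hb).2)) hne
  · obtain ⟨α, β, h1, h2, h3, h4, h5⟩ := main b a hb ha hbS haS h hlab.symm
    exact ⟨α.reverse, β.reverse, h1.reverse, h2.reverse, by simpa using h3, by simpa using h4, by simpa using h5⟩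

/-- the graph obtained by isolating the vertices outside `R` -/
def restrictTo {V : Type} (G : SimpleGraph V) (R : Set V) : SimpleGraph V where
  Adj u v := G.Adj u v ∧ u ∈ R ∧ v ∈ R
  symm := ⟨fun _ _ h => ⟨h.1.symm, h.2.2, h.2.1⟩⟩
  loopless := ⟨fun _ h => h.1.ne rfl⟩

theorem restrictTo_le {V : Type} (G : SimpleGraph V) (R : Set V) : restrictTo G R ≤ G := fun _ _ h => h.1

theorem walk_restrict {V : Type} {G : SimpleGraph V} {R : Set V} {a b : V} (p : G.Walk a b) 
    (h : ∀ v ∈ p.support, v ∈ R) : ∃ q : (restrictTo G R).Walk a b, q.support = p.support := by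
  induction p with
  | nil => exact ⟨Walk.nil, rfl⟩
  | cons e p ih =>
    obtain ⟨q, hq⟩ := ih fun v hv => h v (by simp [hv])
    have e' : (restrictTo G R).Adj _ _ := And.intro e ⟨h _ (by simp), h _ (by simp)⟩
    exact ⟨Walk.cons e' q, by rw [Walk.support_cons, Walk.support_cons, hq]⟩

theorem restrict_support {V : Type} {G : SimpleGraph V} {R : Set V} {a b : V} (p : (restrictTo G R).Walk a b) 
    (ha : a ∈ R) : ∀ v ∈ p.support, v ∈ R := by
  induction p with
  | nil => simpa using ha
  | cons e p ih =>
    intro v hv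
    rw [Walk.support_cons, List.mem_cons] at hv
    rcases hv with rfl | hv
    · exact ha
    · exact ih e.2.2 v hv

theorem separator {V : Type} [Fintype V] [DecidableEq V] (G : SimpleGraph V) {x y : V}
    (X : G.Walk x x) (Y : G.Walk y y) (hX : X.IsCycle) (hY : Y.IsCycle) 
    (mX : ∀ (z : V) (W : G.Walk z z), W.IsCycle → W.length ≤ X.length) 
    (mY : ∀ (z : V) (W : G.Walk z z), W.IsCycle → W.length ≤ Y.length) (k : ℕ) 
    (hk : (X.support.toFinset ∩ Y.support.toFinset).card = k) :
    ∃ T : Finset V, T.card ≤ k + (k + 1) ^ 2 ∧ ∀ a ∈ X.support, ∀ b ∈ Y.support, ∀ p : G.Walk a b, 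
      ∃ v ∈ p.support, v ∈ T := by
  classical
  haveI : Nonempty V := ⟨x⟩
  set S := X.support.toFinset ∩ Y.support.toFinset with hS
  have memS : ∀ v, v ∈ S ↔ v ∈ X.support ∧ v ∈ Y.support := by intro v; simp [hS]
  obtain ⟨lx, lx1, lx2⟩ := arcs_lab X hX S
  obtain ⟨ly, ly1, ly2⟩ := arcs_lab Y hY S
  let A : ℕ → Set V := fun i => {v | v ∈ X.support ∧ v ∉ S ∧ lx v = i}
  let B : ℕ → Set V := fun j => {v | v ∈ Y.support ∧ v ∉ S ∧ ly v = j}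
  let R : ℕ → ℕ → Set V := fun i j => {v | (v ∈ X.support → v ∈ A i) ∧ (v ∈ Y.support → v ∈ B j)}
  have hAR : ∀ i j, A i ⊆ R i j := fun i j v hv => ⟨fun _ => hv, fun h => absurd ((memS v).2 ⟨hv.1, h⟩) hv.2.1⟩
  have hsep : ∀ i j, ¬ NoSep (restrictTo G (R i j)) (A i) (B j) := by
    intro i j hns
    obtain ⟨a, ha, b, hb, c, hc, d, hd, P, Q, hPQ⟩ := menger2 _ _ le_rfl _ _ hns
    obtain ⟨a', ha', c', hc', P', hP', sP, eP1, eP2⟩ := trim_walk _ _ _ ha hc P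
    obtain ⟨b', hb', d', hd', Q', hQ', sQ, eQ1, eQ2⟩ := trim_walk _ _ _ hb hd Q
    have rP := restrict_support P' (hAR i j ha')
    have rQ := restrict_support Q' (hAR i j hb')
    have hdis : ∀ v ∈ P'.support, v ∉ Q'.support := fun v h1 h2 => hPQ v (sP v h1) (sQ v h2)
    have hab : a' ≠ b' := fun h => hdis a' P'.start_mem_support (h ▸ Q'.start_mem_support)
    have hcd : c' ≠ d' := fun h => hdis c' P'.end_mem_support (h ▸ Q'.end_mem_support)
    obtain ⟨α, β, a1, a2, a3, a4, a5⟩ := lx2 a' b' ha'.1 hb'.1 ha'.2.1 hb'.2.1 hab (ha'.2.2.trans hb'.2.2.symm)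
    obtain ⟨γ, δ, c1, c2, c3, c4, c5⟩ := ly2 c' d' hc'.1 hd'.1 hc'.2.1 hd'.2.1 hcd (hc'.2.2.trans hd'.2.2.symm)
    have hle := restrictTo_le G (R i j)
    have pX : ∀ v ∈ P'.support, v ∈ X.support → v = a' := fun v hv h => eP1 v hv ((rP v hv).1 h)
    have pY : ∀ v ∈ P'.support, v ∈ Y.support → v = c' := fun v hv h => eP2 v hv ((rP v hv).2 h)
    have qX : ∀ v ∈ Q'.support, v ∈ X.support → v = b' := fun v hv h => eQ1 v hv ((rQ v hv).1 h)
    have qY : ∀ v ∈ Q'.support, v ∈ Y.support → v = d' := fun v hv h => eQ2 v hv ((rQ v hv).2 h)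
    obtain ⟨z1, W1, w1, w1l⟩ := swap_cycle {v | v ∈ X.support} {v | v ∈ Y.support} β γ (P'.mapLe hle) (Q'.mapLe hle)
      a2 c1 (hP'.mapLe hle) (hQ'.mapLe hle) (by simpa using hdis) a5 
      (fun v hv => ⟨(c4 v hv).1, fun h => (c4 v hv).2 ((memS v).2 ⟨h, (c4 v hv).1⟩)⟩) 
      (by simpa using pX) (by simpa using pY) (by simpa using qX) (by simpa using qY)
    obtain ⟨z2, W2, w2, w2l⟩ := swap_cycle {v | v ∈ Y.support} {v | v ∈ X.support} δ α (P'.mapLe hle).reverse (Q'.mapLe hle).reverse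
      c2 a1 (hP'.mapLe hle).reverse (hQ'.mapLe hle).reverse (by simpa using hdis) c5 
      (fun v hv => ⟨(a4 v hv).1, fun h => (a4 v hv).2 ((memS v).2 ⟨(a4 v hv).1, h⟩)⟩) 
      (by simpa using pY) (by simpa using pX) (by simpa using qY) (by simpa using qX)
    have g1 := mX _ W1 w1
    have g2 := mY _ W2 w2
    simp only [Walk.length_reverse] at w2l
    have hpos : (P'.mapLe hle).length ≠ 0 := by
      intro h
      have := Walk.eq_of_length_eq_zero h
      exact ha'.2.1 ((memS a').2 ⟨ha'.1, this ▸ hc'.1⟩)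
    omega
  unfold NoSep at hsep
  push Not at hsep
  choose z hz using hsep
  refine ⟨S ∪ (Finset.range (k+1) ×ˢ Finset.range (k+1)).image fun ij => z ij.1 ij.2, ?_, ?_⟩
  · refine (Finset.card_union_le _ _).trans (Nat.add_le_add hk.le (Finset.card_image_le.trans ?_))
    simp [sq]
  · intro a ha b hb p
    by_contra hcon
    push Not at hcon
    obtain ⟨a', ha', b', hb', q, hq, sq, e1, e2⟩ := trim_walk G {v | v ∈ X.support} {v | v ∈ Y.support} ha hb p
    have hns : ∀ v ∈ q.support, v ∉ S := fun v hv h => hcon v (sq v hv) (Finset.mem_union_left _ h)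
    have hqR : ∀ v ∈ q.support, v ∈ R (lx a') (ly b') := by
      intro v hv
      refine ⟨fun h => ?_, fun h => ?_⟩
      · obtain rfl := e1 v hv h
        exact ⟨h, hns _ hv, rfl⟩
      · obtain rfl := e2 v hv h
        exact ⟨h, hns _ hv, rfl⟩
    obtain ⟨q', hq'⟩ := walk_restrict q hqR
    have := hz (lx a') (ly b') a' ⟨ha', hns _ q.start_mem_support, rfl⟩ b' ⟨hb', hns _ q.end_mem_support, rfl⟩ q'
    rw [hq'] at this
    refine hcon _ (sq _ this) (Finset.mem_union_right _ ?_)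
    rw [Finset.mem_image]
    refine ⟨(lx a', ly b'), ?_, rfl⟩
    have h1 := lx1 a'
    have h2 := ly1 b'
    simp only [Finset.mem_product, Finset.mem_range]
    omega


theorem iso_dist {V : Type} {G : SimpleGraph V} (hc : G.Connected) (g : G ≃g G) (u v : V) : G.dist (g u) (g v) = G.dist u v := by
  have key : ∀ (g : G ≃g G) u v, G.dist (g u) (g v) ≤ G.dist u v := by
    intro g u v
    obtain ⟨p, hp⟩ := hc.exists_walk_length_eq_dist u v
    have := dist_le (p.map g.toHom)
    rw [Walk.length_map, hp] at this
    exact this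
  refine le_antisymm (key g u v) ?_
  have := key g.symm (g u) (g v)
  simpa using this

open Classical in
/-- closed ball -/
noncomputable def bl {V : Type} [Fintype V] (G : SimpleGraph V) (o : V) (r : ℕ) : Finset V :=
  Finset.univ.filter fun v => G.dist o v ≤ r

open Classical in
/-- sphere -/
noncomputable def sph {V : Type} [Fintype V] (G : SimpleGraph V) (o : V) (r : ℕ) : Finset V :=
  Finset.univ.filter fun v => G.dist o v = r

theorem mem_bl {V : Type} [Fintype V] {G : SimpleGraph V} {o v : V} {r : ℕ} : v ∈ bl G o r ↔ G.dist o v ≤ r := by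
  simp [bl]

theorem mem_sph {V : Type} [Fintype V] {G : SimpleGraph V} {o v : V} {r : ℕ} : v ∈ sph G o r ↔ G.dist o v = r := by
  simp [sph]

theorem bl_card {V : Type} [Fintype V] {G : SimpleGraph V} (hc : G.Connected) (ht : IsVertexTransitive G) (o o' : V) (r : ℕ) :
    (bl G o r).card = (bl G o' r).card := by
  obtain ⟨g, hg⟩ := ht o o'
  refine Finset.card_bij (fun v _ => g v) ?_ (fun _ _ _ _ h => g.injective h) ?_
  · intro v hv; rw [mem_bl] at hv ⊢; rwa [← hg, iso_dist hc]
  · intro v hv; refine ⟨g.symm v, ?_, by simp⟩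
    rw [mem_bl] at hv ⊢; rw [← iso_dist hc g]; simpa [hg] using hv

theorem sph_card {V : Type} [Fintype V] {G : SimpleGraph V} (hc : G.Connected) (ht : IsVertexTransitive G) (o o' : V) (r : ℕ) :
    (sph G o r).card = (sph G o' r).card := by
  obtain ⟨g, hg⟩ := ht o o'
  refine Finset.card_bij (fun v _ => g v) ?_ (fun _ _ _ _ h => g.injective h) ?_
  · intro v hv; rw [mem_sph] at hv ⊢; rwa [← hg, iso_dist hc]
  · intro v hv; refine ⟨g.symm v, ?_, by simp⟩
    rw [mem_sph] at hv ⊢; rw [← iso_dist hc g]; simpa [hg] using hv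

theorem auto_finite {V : Type} [Fintype V] (G : SimpleGraph V) : Finite (G ≃g G) :=
  Finite.of_injective (fun g : G ≃g G => (g : V → V)) (fun _ _ h => RelIso.ext fun x => congrFun h x)

theorem unif {V : Type} [Fintype V] [DecidableEq V] {G : SimpleGraph V} [Fintype (G ≃g G)] (hc : G.Connected) (ht : IsVertexTransitive G) :
    ∃ q : ℕ, 0 < q ∧ ∀ (u : V) (B : Finset V), (Finset.univ.filter fun g : G ≃g G => g u ∈ B).card = q * B.card := by
  obtain ⟨o⟩ := hc.nonempty
  have key : ∀ u v, (Finset.univ.filter fun g : G ≃g G => g u = v).card = (Finset.univ.filter fun g : G ≃g G => g o = o).card := by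
    intro u v
    obtain ⟨h1, e1⟩ := ht o u
    obtain ⟨h2, e2⟩ := ht v o
    refine Finset.card_bij (fun g _ => (h1.trans g).trans h2) ?_ ?_ ?_
    · intro g hg; simp at hg ⊢; rw [e1, hg, e2]
    · intro g _ g' _ h
      refine RelIso.ext fun x => ?_
      have := congrArg (fun f : G ≃g G => f (h1.symm x)) h
      simpa using this
    · intro g hg
      simp at hg
      refine ⟨(h1.symm.trans g).trans h2.symm, ?_, ?_⟩
      · rw [Finset.mem_filter]
        refine ⟨by simp, ?_⟩
        change h2.symm (g (h1.symm u)) = v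
        rw [← e1, RelIso.symm_apply_apply, hg, ← e2, RelIso.symm_apply_apply]
      · refine RelIso.ext fun x => ?_
        simp
  refine ⟨(Finset.univ.filter fun g : G ≃g G => g o = o).card, ?_, ?_⟩
  · exact Finset.card_pos.2 ⟨RelIso.refl _, by simp⟩
  · intro u B
    rw [Finset.card_eq_sum_card_fiberwise (f := fun g : G ≃g G => g u) (t := B) (by intro g hg; simpa using hg)]
    rw [Finset.sum_congr rfl (g := fun _ => (Finset.univ.filter fun g : G ≃g G => g o = o).card)]
    · simp [mul_comm]
    · intro v hv
      rw [← key u v]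
      congr 1
      ext g
      simp only [Finset.mem_filter, Finset.mem_univ, true_and]
      exact ⟨fun h => h.2, fun h => ⟨h ▸ hv, h⟩⟩

theorem meet_count {V : Type} [Fintype V] [DecidableEq V] {G : SimpleGraph V} (hc : G.Connected) (ht : IsVertexTransitive G)
    (A : Finset V) (h : ∀ g : G ≃g G, ∃ a ∈ A, g a ∈ A) : Fintype.card V ≤ A.card ^ 2 := by
  have := auto_finite G
  have := Fintype.ofFinite (G ≃g G)
  obtain ⟨q, hq, hu⟩ := unif hc ht
  obtain ⟨o⟩ := hc.nonempty
  have h1 := hu o Finset.univ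
  simp only [Finset.mem_univ, Finset.filter_true] at h1
  have h2 : (Finset.univ : Finset (G ≃g G)).card ≤ ∑ a ∈ A, (Finset.univ.filter fun g : G ≃g G => g a ∈ A).card := by
    refine le_trans (Finset.card_le_card ?_) Finset.card_biUnion_le
    intro g _
    obtain ⟨a, ha, ha'⟩ := h g
    exact Finset.mem_biUnion.2 ⟨a, ha, by simpa using ha'⟩
  rw [Finset.sum_congr rfl (fun a _ => hu a A), h1, Finset.sum_const, smul_eq_mul] at h2
  have : q * Fintype.card V ≤ q * (A.card ^ 2) := by
    rw [← Finset.card_univ]; nlinarith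
  exact Nat.le_of_mul_le_mul_left this hq

theorem isoperim {V : Type} [Fintype V] [DecidableEq V] {G : SimpleGraph V} (hc : G.Connected) (ht : IsVertexTransitive G)
    (D T : Finset V) (hb : ∀ u ∈ D, ∀ v, v ∉ D → G.Adj u v → v ∈ T) (o : V) (r : ℕ) (h2 : 2 * D.card ≤ (bl G o r).card) :
    D.card ≤ 2 * r * T.card := by
  have := auto_finite G
  have := Fintype.ofFinite (G ≃g G)
  obtain ⟨q, hq, hu⟩ := unif hc ht
  have low : ∀ g ∈ Finset.univ.filter (fun g : G ≃g G => g o ∈ D), (bl G o r).card ≤ 2 * ((bl G o r).filter fun x => g x ∉ D).card := by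
    intro g _
    have e := Finset.card_filter_add_card_filter_not (s := bl G o r) (fun x => g x ∈ D)
    have e2 : ((bl G o r).filter fun x => g x ∈ D).card ≤ D.card :=
      Finset.card_le_card_of_injOn g (by intro x hx; simp at hx; exact hx.2) (fun _ _ _ _ h => g.injective h)
    omega
  have upp : ∀ x ∈ bl G o r, ((Finset.univ.filter (fun g : G ≃g G => g o ∈ D)).filter fun g => g x ∉ D).card ≤ r * (q * T.card) := by
    intro x hx
    rw [mem_bl] at hx
    obtain ⟨p, hp⟩ := hc.exists_walk_length_eq_dist o x
    have : ((Finset.univ.filter (fun g : G ≃g G => g o ∈ D)).filter fun g => g x ∉ D) ⊆ 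
        (Finset.range r).biUnion fun i => Finset.univ.filter fun g : G ≃g G => g (p.getVert (i+1)) ∈ T := by
      intro g hg
      simp only [Finset.mem_filter, Finset.mem_univ, true_and] at hg
      simp only [Finset.mem_biUnion, Finset.mem_filter, Finset.mem_univ, true_and, Finset.mem_range]
      by_contra hcon
      push Not at hcon
      have : ∀ i ≤ p.length, g (p.getVert i) ∈ D := by
        intro i
        induction i with
        | zero => intro _; simpa using hg.1
        | succ i ih =>
          intro hi
          by_contra hD
          exact hcon i (by omega) (hb _ (ih (by omega)) _ hD (g.map_rel_iff.2 (p.adj_getVert_succ (by omega))))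
      exact hg.2 (by simpa using this p.length le_rfl)
    refine (Finset.card_le_card this).trans (Finset.card_biUnion_le.trans ?_)
    rw [Finset.sum_congr rfl (fun i _ => hu _ T)]
    simp
  have l := Finset.sum_le_sum low
  have u := Finset.sum_le_sum upp
  have sw := Finset.sum_card_bipartiteAbove_eq_sum_card_bipartiteBelow (s := Finset.univ.filter (fun g : G ≃g G => g o ∈ D)) (t := bl G o r)
    (fun g x => g x ∉ D)
  unfold Finset.bipartiteAbove Finset.bipartiteBelow at sw
  rw [← Finset.mul_sum, sw, Finset.sum_const, hu o D, smul_eq_mul] at l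
  rw [Finset.sum_const, smul_eq_mul] at u
  have hpos : 0 < (bl G o r).card := Finset.card_pos.2 ⟨o, by simp [mem_bl]⟩
  have : (q * (bl G o r).card) * D.card ≤ (q * (bl G o r).card) * (2 * r * T.card) := by nlinarith
  exact Nat.le_of_mul_le_mul_left this (by positivity)

theorem exists_dist {V : Type} {G : SimpleGraph V} (hc : G.Connected) (o v : V) (s : ℕ) (hs : s ≤ G.dist o v) : 
    ∃ u, G.dist o u = s := by
  obtain ⟨p, hp⟩ := hc.exists_walk_length_eq_dist o v
  refine ⟨p.getVert s, le_antisymm ?_ ?_⟩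
  · refine (dist_le (p.take s)).trans ?_
    rw [Walk.take_length]; omega
  · have h1 := hc.dist_triangle (u := o) (v := p.getVert s) (w := v)
    have h2 := dist_le (p.drop s)
    rw [Walk.drop_length] at h2
    omega

theorem growth {V : Type} [Fintype V] [DecidableEq V] {G : SimpleGraph V} (hc : G.Connected) (ht : IsVertexTransitive G) (o : V)
    (r0 M : ℕ) (h : (bl G o r0).card < Fintype.card V) (j : ℕ) (hj : j * (2 * M + 1) ≤ r0) :
    j * (bl G o M).card ≤ (bl G o (j * (2 * M + 1))).card := by
  have : ∃ v, v ∉ bl G o r0 := by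
    by_contra hcon
    push Not at hcon
    rw [Finset.eq_univ_iff_forall.2 hcon, Finset.card_univ] at h
    omega
  obtain ⟨v, hv⟩ := this
  rw [mem_bl] at hv
  induction j with
  | zero => simp
  | succ j ih =>
    have ih := ih (le_trans (Nat.mul_le_mul_right _ (Nat.le_succ j)) hj)
    have e : (j + 1) * (2 * M + 1) = j * (2 * M + 1) + (2 * M + 1) := by ring
    rw [e] at hj ⊢
    generalize j * (2 * M + 1) = r at *
    obtain ⟨u, hu⟩ := exists_dist hc o v (r + M + 1) (by omega)
    have hdis : Disjoint (bl G o r) (bl G u M) := by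
      rw [Finset.disjoint_left]
      intro x hx hx'
      rw [mem_bl] at hx hx'
      have := hc.dist_triangle (u := o) (v := x) (w := u)
      rw [dist_comm (u := x)] at this
      omega
    have hsub : bl G o r ∪ bl G u M ⊆ bl G o (r + (2 * M + 1)) := by
      intro x hx
      rw [Finset.mem_union, mem_bl, mem_bl] at hx
      rw [mem_bl]
      have := hc.dist_triangle (u := o) (v := u) (w := x)
      rcases hx with hx | hx <;> omega
    have := Finset.card_le_card hsub
    rw [Finset.card_union_of_disjoint hdis, bl_card hc ht u o] at this
    linarith [add_mul j 1 (bl G o M).card]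

theorem small_sphere {V : Type} [Fintype V] [DecidableEq V] {G : SimpleGraph V} (hc : G.Connected) (ht : IsVertexTransitive G)
    (D T : Finset V) (hb : ∀ u ∈ D, ∀ v, v ∉ D → G.Adj u v → v ∈ T) (t m : ℕ) (hT : T.card ≤ t) (ht1 : 1 ≤ t) (hm : 1 ≤ m)
    (hn : 2 * D.card ≤ Fintype.card V) (hL : 2 * t * (4 * m + 1) + 1 ≤ D.card) :
    ∃ ρ, m < ρ ∧ ρ ≤ 2 * m ∧ ∀ o, (sph G o ρ).card ≤ 40 * t ∧ (bl G o (2 * m)).card ≤ 40 * t * m := by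
  obtain ⟨o⟩ := hc.nonempty
  obtain ⟨r0, hr0⟩ : ∃ r0, r0 = (D.card - 1) / (2 * t) := ⟨_, rfl⟩
  have a1 : 2 * t * r0 ≤ D.card - 1 := by rw [hr0]; exact Nat.mul_div_le _ _
  have a2 : D.card - 1 < 2 * t * (r0 + 1) := by 
    rw [hr0]; exact Nat.lt_mul_div_succ _ (by omega)
  have a3 : 4 * m + 1 ≤ r0 := by
    rw [hr0, Nat.le_div_iff_mul_le (by omega)]; rw [mul_comm]; omega
  have a4 : (bl G o r0).card < 2 * D.card := by
    by_contra hcon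
    have := isoperim hc ht D T hb o r0 (by omega)
    have h3 : 2 * r0 * T.card ≤ 2 * t * r0 := by nlinarith
    omega
  have gr := growth hc ht o r0 (2 * m) (by omega) (r0 / (2 * (2 * m) + 1)) (Nat.div_mul_le_self _ _)
  obtain ⟨j, hj⟩ : ∃ j, j = r0 / (2 * (2 * m) + 1) := ⟨_, rfl⟩
  rw [← hj] at gr
  have j1 : j * (2 * (2 * m) + 1) ≤ r0 := by rw [hj]; exact Nat.div_mul_le_self _ _
  have j2 : r0 < (2 * (2 * m) + 1) * (j + 1) := by rw [hj]; exact Nat.lt_mul_div_succ _ (by omega)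
  have j3 : 1 ≤ j := by rw [hj, Nat.le_div_iff_mul_le (by omega)]; omega
  have mono : (bl G o (j * (2 * (2 * m) + 1))).card ≤ (bl G o r0).card := 
    Finset.card_le_card fun x hx => by rw [mem_bl] at hx ⊢; omega
  have hball : (bl G o (2 * m)).card < 40 * t * m := by
    have b1 : j * (bl G o (2 * m)).card < 4 * t * (r0 + 1) := by
      have : 4 * t * (r0 + 1) = 2 * (2 * t * (r0 + 1)) := by ring
      omega
    have b2 : r0 + 1 ≤ j * (10 * m) := by
      have : r0 + 1 ≤ (4 * m + 1) * (j + 1) := by rw [show 2 * (2 * m) = 4 * m by ring] at j2; exact j2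
      nlinarith
    have b3 : j * (bl G o (2 * m)).card < j * (40 * t * m) := by
      calc _ < 4 * t * (r0 + 1) := b1
        _ ≤ 4 * t * (j * (10 * m)) := Nat.mul_le_mul_left _ b2
        _ = _ := by ring
    exact Nat.lt_of_mul_lt_mul_left b3
  have : ∃ ρ ∈ Finset.Ioc m (2 * m), (sph G o ρ).card ≤ 40 * t := by
    by_contra hcon
    push Not at hcon
    have s1 : ∑ ρ ∈ Finset.Ioc m (2 * m), (40 * t) ≤ ∑ ρ ∈ Finset.Ioc m (2 * m), (sph G o ρ).card :=
      Finset.sum_le_sum fun ρ hρ => (hcon ρ hρ).le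
    rw [← Finset.card_biUnion] at s1
    · have s2 : ((Finset.Ioc m (2 * m)).biUnion fun ρ => sph G o ρ).card ≤ (bl G o (2 * m)).card := by
        refine Finset.card_le_card ?_
        intro x hx
        simp only [Finset.mem_biUnion, Finset.mem_Ioc, mem_sph] at hx
        obtain ⟨ρ, h1, h2⟩ := hx
        rw [mem_bl]; omega
      rw [Finset.sum_const, Nat.card_Ioc, smul_eq_mul, show 2 * m - m = m by omega] at s1
      have : m * (40 * t) = 40 * t * m := by ring
      have s3 := s1.trans s2
      omega
    · intro i _ j _ hij
      rw [Function.onFun, Finset.disjoint_left]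
      intro x hx hx'
      rw [mem_sph] at hx hx'
      omega
  obtain ⟨ρ, hρ, hs⟩ := this
  rw [Finset.mem_Ioc] at hρ
  refine ⟨ρ, hρ.1, hρ.2, fun o' => ?_⟩
  rw [sph_card hc ht o' o, bl_card hc ht o' o]
  exact ⟨hs, hball.le⟩


theorem no_cut {V : Type} [Fintype V] {G : SimpleGraph V} (hc : G.Connected) (ht : IsVertexTransitive G)
    (z a b : V) (ha : a ≠ z) (hb : b ≠ z) : ∃ p : G.Walk a b, z ∉ p.support := by
  obtain ⟨v, hv⟩ := hc.exists_preconnected_induce_compl_singleton_of_finite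
  obtain ⟨g, hg⟩ := ht z v
  have ha' : g a ∈ ({v}ᶜ : Set V) := by
    rw [Set.mem_compl_singleton_iff, ← hg]; exact fun h => ha (g.injective h)
  have hb' : g b ∈ ({v}ᶜ : Set V) := by
    rw [Set.mem_compl_singleton_iff, ← hg]; exact fun h => hb (g.injective h)
  obtain ⟨p⟩ := hv ⟨g a, ha'⟩ ⟨g b, hb'⟩
  have q := (p.map (Embedding.induce _).toHom).map g.symm.toHom
  refine ⟨((p.map (Embedding.induce _).toHom).map g.symm.toHom).copy (by simp) (by simp), ?_⟩
  rw [Walk.support_copy, Walk.support_map, Walk.support_map]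
  intro h
  simp only [List.map_map, List.mem_map] at h
  obtain ⟨w, _, hw⟩ := h
  have : (w : V) = g z := by rw [← hw]; simp
  exact w.2 (by rw [this, hg]; rfl)

theorem cycle_card {V : Type} [DecidableEq V] {G : SimpleGraph V} {x : V} (X : G.Walk x x) (hX : X.IsCycle) :
    X.support.toFinset.card = X.length := by
  have h1 : X.support.toFinset = X.support.tail.toFinset := by
    ext v
    simp only [List.mem_toFinset]
    rw [Walk.mem_support_iff]
    constructor
    · rintro (rfl | h)
      · exact Walk.end_mem_tail_support hX.not_nil
      · exact h
    · exact Or.inr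
  rw [h1, List.toFinset_card_of_nodup hX.support_nodup, List.length_tail, Walk.length_support]
  rfl

theorem longest_meet {V : Type} [Fintype V] [DecidableEq V] {G : SimpleGraph V} (hc : G.Connected) (ht : IsVertexTransitive G)
    {x y : V} (X : G.Walk x x) (Y : G.Walk y y) (hX : IsLongestCycle G X) (hY : IsLongestCycle G Y) :
    (X.support.toFinset ∩ Y.support.toFinset).card ≠ 0 := by
  intro h0
  obtain ⟨T, hT, hsep⟩ := separator G X Y hX.1 hY.1 hX.2 hY.2 0 h0
  have hT1 : T.card ≤ 1 := by simpa using hT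
  have two : ∀ {x : V} (X : G.Walk x x), X.IsCycle → ∀ z, ∃ a ∈ X.support, a ≠ z := by
    intro x X hX z
    by_cases h : x = z
    · subst h
      have := hX.three_le_length
      have hadj := X.adj_getVert_succ (i := 0) (by omega)
      rw [Walk.getVert_zero] at hadj
      exact ⟨_, X.getVert_mem_support (0 + 1), hadj.ne'⟩
    · exact ⟨x, X.start_mem_support, h⟩
  have : Nonempty V := ⟨x⟩
  rcases Finset.card_le_one_iff_subset_singleton.1 hT1 with ⟨z, hz⟩
  obtain ⟨a, ha, haz⟩ := two X hX.1 z
  obtain ⟨b, hb, hbz⟩ := two Y hY.1 z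
  obtain ⟨p, hp⟩ := no_cut hc ht z a b haz hbz
  obtain ⟨v, hv, hvT⟩ := hsep a ha b hb p
  have := Finset.mem_singleton.1 (hz hvT)
  exact hp (this ▸ hv)

theorem longest_map {V : Type} {G : SimpleGraph V} {x : V} (X : G.Walk x x) (hX : IsLongestCycle G X) (g : G ≃g G) :
    IsLongestCycle G (X.map g.toHom) := by
  refine ⟨hX.1.map g.injective, fun y W hW => ?_⟩
  rw [Walk.length_map]; exact hX.2 y W hW

theorem n_le_sq {V : Type} [Fintype V] [DecidableEq V] {G : SimpleGraph V} (hc : G.Connected) (ht : IsVertexTransitive G)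
    {x : V} (X : G.Walk x x) (hX : IsLongestCycle G X) : Fintype.card V ≤ X.length ^ 2 := by
  rw [← cycle_card X hX.1]
  refine meet_count hc ht _ fun g => ?_
  have := longest_meet hc ht X (X.map g.toHom) hX (longest_map X hX g)
  obtain ⟨v, hv⟩ := Finset.card_ne_zero.1 this
  rw [Finset.mem_inter, List.mem_toFinset, List.mem_toFinset, Walk.support_map, List.mem_map] at hv
  obtain ⟨hv, a, ha, rfl⟩ := hv
  exact ⟨a, by simpa using ha, by simpa using hv⟩

theorem exists_side {V : Type} [Fintype V] [DecidableEq V] {G : SimpleGraph V} {x y : V} (X : G.Walk x x) (Y : G.Walk y y)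
    (T : Finset V) (L : ℕ) (hX : X.support.toFinset.card = L) (hY : Y.support.toFinset.card = L)
    (hsep : ∀ a ∈ X.support, ∀ b ∈ Y.support, ∀ p : G.Walk a b, ∃ v ∈ p.support, v ∈ T) :
    ∃ D : Finset V, (∀ u ∈ D, ∀ v, v ∉ D → G.Adj u v → v ∈ T) ∧ 2 * D.card ≤ Fintype.card V ∧ L ≤ D.card + T.card := by
  classical
  let A : Finset V := Finset.univ.filter fun v => ∃ a ∈ X.support, ∃ p : G.Walk a v, ∀ u ∈ p.support, u ∉ T
  let B : Finset V := Finset.univ.filter fun v => v ∉ A ∧ v ∉ T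
  have memA : ∀ v, v ∈ A ↔ ∃ a ∈ X.support, ∃ p : G.Walk a v, ∀ u ∈ p.support, u ∉ T := by intro v; simp [A]
  have memB : ∀ v, v ∈ B ↔ v ∉ A ∧ v ∉ T := by intro v; simp [B]
  have ext : ∀ u v, u ∈ A → G.Adj u v → v ∉ T → v ∈ A := by
    intro u v hu huv hv
    obtain ⟨a, ha, p, hp⟩ := (memA u).1 hu
    refine (memA v).2 ⟨a, ha, p.concat huv, ?_⟩
    intro w hw
    rw [Walk.support_concat, List.mem_append, List.mem_singleton] at hw
    rcases hw with hw | rfl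
    · exact hp w hw
    · exact hv
  have hXA : L ≤ A.card + T.card := by
    rw [← hX]
    refine (Finset.card_le_card ?_).trans (Finset.card_union_le _ _)
    intro v hv
    rw [List.mem_toFinset] at hv
    by_cases hvT : v ∈ T
    · exact Finset.mem_union_right _ hvT
    · exact Finset.mem_union_left _ ((memA v).2 ⟨v, hv, Walk.nil, by simpa using hvT⟩)
  have hYB : L ≤ B.card + T.card := by
    rw [← hY]
    refine (Finset.card_le_card ?_).trans (Finset.card_union_le _ _)
    intro v hv
    rw [List.mem_toFinset] at hv
    by_cases hvT : v ∈ T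
    · exact Finset.mem_union_right _ hvT
    · refine Finset.mem_union_left _ ((memB v).2 ⟨fun hA => ?_, hvT⟩)
      obtain ⟨a, ha, p, hp⟩ := (memA v).1 hA
      obtain ⟨w, hw, hwT⟩ := hsep a ha v hv p
      exact hp w hw hwT
  have hdis : Disjoint A B := Finset.disjoint_right.2 fun v hv => ((memB v).1 hv).1
  have hcard := Finset.card_le_univ (A ∪ B)
  rw [Finset.card_union_of_disjoint hdis] at hcard
  by_cases h : A.card ≤ B.card
  · refine ⟨A, fun u hu v hv huv => ?_, by omega, hXA⟩
    by_contra hvT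
    exact hv (ext u v hu huv hvT)
  · refine ⟨B, fun u hu v hv huv => ?_, by omega, hYB⟩
    by_contra hvT
    have hvA : v ∈ A := by
      by_contra hvA
      exact hv ((memB v).2 ⟨hvA, hvT⟩)
    exact ((memB u).1 hu).1 (ext v u hvA huv.symm ((memB u).1 hu).2)


/-- edges meeting `I` -/
def inG {V : Type} (C : SimpleGraph V) (I : Set V) : SimpleGraph V where
  Adj u v := C.Adj u v ∧ (u ∈ I ∨ v ∈ I)
  symm := ⟨fun _ _ h => ⟨h.1.symm, h.2.symm⟩⟩
  loopless := ⟨fun _ h => h.1.ne rfl⟩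

/-- edges avoiding `I` -/
def outG {V : Type} (C : SimpleGraph V) (I : Set V) : SimpleGraph V where
  Adj u v := C.Adj u v ∧ u ∉ I ∧ v ∉ I
  symm := ⟨fun _ _ h => ⟨h.1.symm, h.2.2, h.2.1⟩⟩
  loopless := ⟨fun _ h => h.1.ne rfl⟩

theorem inG_adj {V : Type} {C : SimpleGraph V} {I : Set V} {u v : V} : (inG C I).Adj u v ↔ C.Adj u v ∧ (u ∈ I ∨ v ∈ I) := Iff.rfl
theorem outG_adj {V : Type} {C : SimpleGraph V} {I : Set V} {u v : V} : (outG C I).Adj u v ↔ C.Adj u v ∧ u ∉ I ∧ v ∉ I := Iff.rfl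

theorem mem_supp_iff {V : Type} [Finite V] {C : SimpleGraph V} {v : V} : v ∈ C.support ↔ (C.neighborSet v).ncard ≠ 0 := by
  rw [mem_support, ← Nat.pos_iff_ne_zero, Set.ncard_pos]; rfl

/-- `C` is a single cycle of length `L` in `G` -/
structure CycG {V : Type} (G : SimpleGraph V) (L : ℕ) (C : SimpleGraph V) : Prop where
  le : C ≤ G
  cyc : ∀ v ∈ C.support, (C.neighborSet v).ncard = 2
  conn : ∀ u ∈ C.support, ∀ v ∈ C.support, C.Reachable u v
  card : C.support.ncard = L

theorem cyc_bound {V : Type} [Fintype V] [DecidableEq V] {G : SimpleGraph V} {L : ℕ} (hL : ∀ (z : V) (W : G.Walk z z), W.IsCycle → W.length ≤ L)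
    (W : SimpleGraph V) (le : W ≤ G) (cyc : ∀ v ∈ W.support, (W.neighborSet v).ncard = 2)
    (conn : ∀ u ∈ W.support, ∀ v ∈ W.support, W.Reachable u v) : W.support.ncard ≤ L := by
  by_cases hne : W.support.Nonempty
  · obtain ⟨v, hv⟩ := hne
    have hc : W.IsCycles := fun u hu => cyc u hu
    obtain ⟨p, hp, hpv⟩ := hc.exists_cycle_toSubgraph_verts_eq_connectedComponentSupp (c := W.connectedComponentMk v) (v := v) rfl hv
    have h1 := hL _ (p.mapLe le) (hp.mapLe le)
    have h2 : (p.mapLe le).length = p.length := Walk.length_map _ _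
    have h3 := cycle_card p hp
    have h4 : W.support ⊆ (p.support.toFinset : Set V) := by
      intro u hu
      have : u ∈ p.toSubgraph.verts := by
        rw [hpv]
        exact ConnectedComponent.sound (conn u hu v hv)
      simpa using this
    have h5 := Set.ncard_le_ncard h4
    rw [Set.ncard_coe_finset] at h5
    omega
  · rw [Set.not_nonempty_iff_eq_empty] at hne
    rw [hne]; simp

theorem walk_cycG {V : Type} [Fintype V] [DecidableEq V] {G : SimpleGraph V} {x : V} (X : G.Walk x x) (hX : X.IsCycle) :
    CycG G X.length X.toSubgraph.spanningCoe ∧ X.toSubgraph.spanningCoe.support = (X.support.toFinset : Set V) := by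
  have hs : X.toSubgraph.spanningCoe.support = (X.support.toFinset : Set V) := by
    ext v
    rw [mem_supp_iff]
    constructor
    · intro h
      obtain ⟨w, hw⟩ := Set.nonempty_of_ncard_ne_zero h
      have : v ∈ X.toSubgraph.verts := X.toSubgraph.edge_vert hw
      simpa using this
    · intro h
      have : v ∈ X.support := by simpa using h
      have h2 := hX.ncard_neighborSet_toSubgraph_eq_two this
      change (X.toSubgraph.neighborSet v).ncard ≠ 0
      omega
  refine ⟨⟨Subgraph.spanningCoe_le _, ?_, ?_, ?_⟩, hs⟩
  · intro v hv
    rw [hs] at hv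
    exact hX.ncard_neighborSet_toSubgraph_eq_two (by simpa using hv)
  · intro u hu v hv
    rw [hs] at hu hv
    have hu' : u ∈ X.toSubgraph.verts := by simpa using hu
    have hv' : v ∈ X.toSubgraph.verts := by simpa using hv
    have := X.toSubgraph_connected.preconnected ⟨u, hu'⟩ ⟨v, hv'⟩
    exact this.map (⟨Subtype.val, fun h => h⟩ : X.toSubgraph.coe →g X.toSubgraph.spanningCoe)
  · rw [hs, Set.ncard_coe_finset, cycle_card X hX]

theorem claim1 {V : Type} {C : SimpleGraph V} {I F : Set V} (hF : ∀ u ∈ I, ∀ v, C.Adj u v → v ∈ I ∨ v ∈ F) {u c : V} (p : C.Walk u c)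
    (hc : c ∉ I) : u ∈ I → ∃ f ∈ F, f ∉ I ∧ (inG C I).Reachable u f ∧ f ∈ (inG C I).support := by
  induction p with
  | nil => exact fun h => absurd h hc
  | @cons u u1 c e p ih =>
    intro hu
    have e' : (inG C I).Adj u u1 := ⟨e, Or.inl hu⟩
    by_cases h1 : u1 ∈ I
    · obtain ⟨f, hf, h2, h3, h4⟩ := ih hc h1
      exact ⟨f, hf, h2, e'.reachable.trans h3, h4⟩
    · exact ⟨u1, (hF u hu u1 e).resolve_left h1, h1, e'.reachable, ⟨u, e'.symm⟩⟩

theorem claim2 {V : Type} {C D : SimpleGraph V} {I F : Set V} 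
    (hD : ∀ u ∈ I, ∀ v, D.Adj u v → v ∈ I ∨ v ∈ F)
    (hst : ∀ f ∈ F, ∀ f' ∈ F, (inG D I).Reachable f f' → (inG C I).Reachable f f') {u v : V} (p : D.Walk u v) (hv : v ∉ I) : 
    (u ∉ I → (inG C I ⊔ outG D I).Reachable u v) ∧ 
    (u ∈ I → ∃ f ∈ F, (inG D I).Reachable u f ∧ (inG C I ⊔ outG D I).Reachable f v) := by
  induction p with
  | nil => exact ⟨fun _ => Reachable.refl _, fun h => absurd h hv⟩
  | @cons u u1 v e p ih =>
    obtain ⟨ih1, ih2⟩ := ih hv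
    refine ⟨fun hu => ?_, fun hu => ?_⟩
    · by_cases h1 : u1 ∈ I
      · obtain ⟨f, hf, h2, h3⟩ := ih2 h1
        have huF := (hD u1 h1 u e.symm).resolve_left hu
        have e' : (inG D I).Adj u u1 := ⟨e, Or.inr h1⟩
        exact ((hst u huF f hf (e'.reachable.trans h2)).mono le_sup_left).trans h3
      · have e' : (outG D I).Adj u u1 := ⟨e, hu, h1⟩
        exact (e'.reachable.mono le_sup_right).trans (ih1 h1)
    · have e' : (inG D I).Adj u u1 := ⟨e, Or.inl hu⟩
      by_cases h1 : u1 ∈ I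
      · obtain ⟨f, hf, h2, h3⟩ := ih2 h1
        exact ⟨f, hf, e'.reachable.trans h2, h3⟩
      · exact ⟨u1, (hD u hu u1 e).resolve_left h1, e'.reachable, ih1 h1⟩

theorem nbr_split {V : Type} [Finite V] (C D : SimpleGraph V) {I : Set V} {v : V} (hv : v ∉ I) :
    ((inG C I ⊔ outG D I).neighborSet v).ncard = ((inG C I).neighborSet v).ncard + ((outG D I).neighborSet v).ncard := by
  rw [← Set.ncard_union_eq]
  · rfl
  · rw [Set.disjoint_left]
    intro w h1 h2
    have h1' : (inG C I).Adj v w := h1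
    have h2' : (outG D I).Adj v w := h2
    rcases h1'.2 with h | h
    · exact hv h
    · exact h2'.2.2 h

theorem in_sup_out {V : Type} (D : SimpleGraph V) (I : Set V) : inG D I ⊔ outG D I = D := by
  ext u v
  rw [sup_adj, inG_adj, outG_adj]
  tauto

theorem surgery {V : Type} [Fintype V] [DecidableEq V] {G : SimpleGraph V} {L : ℕ} (hL : ∀ (z : V) (W : G.Walk z z), W.IsCycle → W.length ≤ L)
    {C D : SimpleGraph V} (hC : CycG G L C) (hD : CycG G L D) {I F : Set V} (hF : ∀ u ∈ I, ∀ v, G.Adj u v → v ∈ I ∨ v ∈ F)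
    (hCI : ¬ C.support ⊆ I) 
    (hdeg : ∀ f ∈ F, ((inG C I).neighborSet f).ncard = ((inG D I).neighborSet f).ncard)
    (hst : ∀ f ∈ F, ∀ f' ∈ F, (inG D I).Reachable f f' → (inG C I).Reachable f f') : 
    (C.support ∩ I).ncard ≤ (D.support ∩ I).ncard := by
  have hCF : ∀ u ∈ I, ∀ v, C.Adj u v → v ∈ I ∨ v ∈ F := fun u hu v h => hF u hu v (hC.le h)
  have hDF : ∀ u ∈ I, ∀ v, D.Adj u v → v ∈ I ∨ v ∈ F := fun u hu v h => hF u hu v (hD.le h)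
  obtain ⟨c0, hc0, hc0I⟩ := Set.not_subset.1 hCI
  obtain ⟨W, hW⟩ : ∃ W, W = inG C I ⊔ outG D I := ⟨_, rfl⟩
  have nI : ∀ v ∈ I, W.neighborSet v = C.neighborSet v := by
    intro v hv
    ext w
    rw [mem_neighborSet, mem_neighborSet, hW, sup_adj, inG_adj, outG_adj]
    tauto
  have nO : ∀ v, v ∉ I → (W.neighborSet v).ncard = (D.neighborSet v).ncard := by
    intro v hv
    rw [hW, nbr_split C D hv]
    conv_rhs => rw [← in_sup_out D I, nbr_split D D hv]
    congr 1
    by_cases hvF : v ∈ F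
    · exact hdeg v hvF
    · have e : ∀ E : SimpleGraph V, (∀ u ∈ I, ∀ v, E.Adj u v → v ∈ I ∨ v ∈ F) → (inG E I).neighborSet v = ∅ := by
        intro E hE
        rw [Set.eq_empty_iff_forall_notMem]
        intro w hw
        have hw' : (inG E I).Adj v w := hw
        rcases hw'.2 with h | h
        · exact hv h
        · rcases hE w h v hw'.1.symm with h | h
          · exact hv h
          · exact hvF h
      rw [e C hCF, e D hDF]
  have sI : ∀ v ∈ I, (v ∈ W.support ↔ v ∈ C.support) := by
    intro v hv; rw [mem_supp_iff, mem_supp_iff, nI v hv]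
  have sO : ∀ v, v ∉ I → (v ∈ W.support ↔ v ∈ D.support) := by
    intro v hv; rw [mem_supp_iff, mem_supp_iff, nO v hv]
  have reach : ∀ u ∈ W.support, ∃ u', u' ∉ I ∧ u' ∈ D.support ∧ W.Reachable u u' := by
    intro u hu
    by_cases h : u ∈ I
    · obtain ⟨p⟩ := hC.conn u ((sI u h).1 hu) c0 hc0
      obtain ⟨f, hf, hfI, h3, h4⟩ := claim1 hCF p hc0I h
      refine ⟨f, hfI, (sO f hfI).1 ?_, by rw [hW]; exact h3.mono le_sup_left⟩
      obtain ⟨w, hw⟩ := h4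
      exact ⟨w, by rw [hW]; exact Or.inl hw⟩
    · exact ⟨u, h, (sO u h).1 hu, Reachable.refl _⟩
  have hWG : W ≤ G := by
    rw [hW]
    exact sup_le (fun _ _ h => hC.le h.1) (fun _ _ h => hD.le h.1)
  have bd := cyc_bound hL W hWG (by
      intro v hv
      by_cases h : v ∈ I
      · rw [nI v h]; exact hC.cyc v ((sI v h).1 hv)
      · rw [nO v h]; exact hD.cyc v ((sO v h).1 hv)) (by
      intro u hu v hv
      obtain ⟨u', h1, h2, h3⟩ := reach u hu
      obtain ⟨v', g1, g2, g3⟩ := reach v hv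
      obtain ⟨p⟩ := hD.conn u' h2 v' g2
      have := (claim2 hDF hst p g1).1 h1
      rw [← hW] at this
      exact h3.trans (this.trans g3.symm))
  have eW : W.support = (C.support ∩ I) ∪ (D.support \ I) := by
    ext v
    by_cases h : v ∈ I
    · simp [sI v h, h]
    · simp [sO v h, h]
  rw [eW, Set.ncard_union_eq (by
    rw [Set.disjoint_left]; exact fun v h1 h2 => h2.2 h1.2)] at bd
  have := Set.ncard_inter_add_ncard_sdiff_eq_ncard D.support I
  rw [hD.card] at this
  omega


open Classical in
/-- the trace of `C` on `I` as seen from `F` -/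
noncomputable def stt {V : Type} (I F : Finset V) (C : SimpleGraph V) : F → Fin 3 × F := fun f =>
  (⟨min ((inG C (I : Set V)).neighborSet f).ncard 2, by omega⟩,
    @Classical.epsilon F ⟨f⟩ fun f' => (inG C (I : Set V)).Reachable f f')

theorem stt_deg {V : Type} [Fintype V] {I F : Finset V} {G C D : SimpleGraph V} {L : ℕ} (hC : CycG G L C) (hD : CycG G L D)
    (h : stt I F C = stt I F D) : 
    ∀ f ∈ F, ((inG C (I : Set V)).neighborSet f).ncard = ((inG D (I : Set V)).neighborSet f).ncard := by
  intro f hf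
  have h1 := congrArg Prod.fst (congrFun h ⟨f, hf⟩)
  simp only [stt, Fin.mk.injEq] at h1
  have key : ∀ E : SimpleGraph V, CycG G L E → ((inG E (I : Set V)).neighborSet f).ncard ≤ 2 := by
    intro E hE
    have : ((inG E (I : Set V)).neighborSet f).ncard ≤ (E.neighborSet f).ncard := 
      Set.ncard_le_ncard (fun w hw => hw.1)
    by_cases hs : f ∈ E.support
    · rw [hE.cyc f hs] at this; exact this
    · rw [mem_supp_iff] at hs; omega
  have := key C hC
  have := key D hD
  omega

theorem stt_reach {V : Type} [Fintype V] {I F : Finset V} {C D : SimpleGraph V} 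
    (h : stt I F C = stt I F D) : 
    ∀ f ∈ F, ∀ f' ∈ F, (inG D (I : Set V)).Reachable f f' → (inG C (I : Set V)).Reachable f f' := by
  intro f hf f' hf' hr
  have h1 := congrArg Prod.snd (congrFun h ⟨f, hf⟩)
  have h2 := congrArg Prod.snd (congrFun h ⟨f', hf'⟩)
  have h3 : (stt I F D ⟨f, hf⟩).2 = (stt I F D ⟨f', hf'⟩).2 := by
    simp only [stt]
    congr 1
    funext w
    exact propext ⟨fun h => hr.symm.trans h, fun h => hr.trans h⟩
  have sp : ∀ f (hf : f ∈ F), (inG C (I : Set V)).Reachable f (stt I F C ⟨f, hf⟩).2 := by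
    intro f hf
    exact @Classical.epsilon_spec F (fun f' => (inG C (I : Set V)).Reachable f f') ⟨⟨f, hf⟩, Reachable.refl _⟩
  have s1 := sp f hf
  have s2 := sp f' hf'
  rw [h1, h3, ← h2] at s1
  exact s1.trans s2.symm

theorem values_bound {V : Type} [Nonempty V] [Fintype V] [DecidableEq V] {G : SimpleGraph V} {L : ℕ} (hL : ∀ (z : V) (W : G.Walk z z), W.IsCycle → W.length ≤ L)
    (Cs : V → SimpleGraph V) (hCs : ∀ v, CycG G L (Cs v)) (I F : Finset V) (hF : ∀ u ∈ I, ∀ v, G.Adj u v → v ∈ I ∨ v ∈ F) :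
    (Finset.univ.image fun v => ((Cs v).support ∩ (I : Set V)).ncard).card ≤ (3 * F.card) ^ F.card + 1 := by
  classical
  have hF' : ∀ u ∈ (I : Set V), ∀ v, G.Adj u v → v ∈ (I : Set V) ∨ v ∈ (F : Set V) := fun u hu v h => hF u hu v h
  have key : ∀ u v, ¬ (Cs u).support ⊆ (I : Set V) → ¬ (Cs v).support ⊆ (I : Set V) → stt I F (Cs u) = stt I F (Cs v) → 
      ((Cs u).support ∩ (I : Set V)).ncard = ((Cs v).support ∩ (I : Set V)).ncard := by
    intro u v hu hv h
    exact le_antisymm (surgery hL (hCs u) (hCs v) hF' hu (stt_deg (hCs u) (hCs v) h) (stt_reach h))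
      (surgery hL (hCs v) (hCs u) hF' hv (stt_deg (hCs v) (hCs u) h.symm) (stt_reach h.symm))
  let S := Finset.univ.filter fun v => ¬ (Cs v).support ⊆ (I : Set V)
  have hS : ∀ v, v ∈ S ↔ ¬ (Cs v).support ⊆ (I : Set V) := by intro v; simp [S]
  have sub : (Finset.univ.image fun v => ((Cs v).support ∩ (I : Set V)).ncard) ⊆ 
      (S.image fun v => ((Cs v).support ∩ (I : Set V)).ncard) ∪ {L} := by
    intro n hn
    obtain ⟨v, _, rfl⟩ := Finset.mem_image.1 hn
    by_cases hv : (Cs v).support ⊆ (I : Set V)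
    · rw [Set.inter_eq_left.2 hv, (hCs v).card]; simp
    · exact Finset.mem_union_left _ (Finset.mem_image_of_mem _ ((hS v).2 hv))
  refine (Finset.card_le_card sub).trans ((Finset.card_union_le _ _).trans ?_)
  rw [Finset.card_singleton]
  refine Nat.add_le_add_right ?_ 1
  have hcard : Fintype.card (F → Fin 3 × F) = (3 * F.card) ^ F.card := by simp
  rw [← hcard, ← Finset.card_univ]
  have ex : ∀ n, ∃ v, n ∈ (S.image fun v => ((Cs v).support ∩ (I : Set V)).ncard) → v ∈ S ∧ ((Cs v).support ∩ (I : Set V)).ncard = n := by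
    intro n
    by_cases hn : n ∈ (S.image fun v => ((Cs v).support ∩ (I : Set V)).ncard)
    · obtain ⟨v, hv, e⟩ := Finset.mem_image.1 hn
      exact ⟨v, fun _ => ⟨hv, e⟩⟩
    · exact ⟨Classical.arbitrary V, fun h => absurd h hn⟩
  choose rep hrep using ex
  refine Finset.card_le_card_of_injOn (fun n => stt I F (Cs (rep n))) (fun _ _ => Finset.mem_univ _) ?_
  intro n hn n' hn' h
  obtain ⟨a1, a2⟩ := hrep n hn
  obtain ⟨b1, b2⟩ := hrep n' hn'
  rw [← a2, ← b2]
  exact key _ _ ((hS _).1 a1) ((hS _).1 b1) h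

theorem walk_ivt {V : Type} {G : SimpleGraph V} (h : V → ℕ) (hs : ∀ u v, G.Adj u v → h v ≤ h u + 1) {u v : V} (p : G.Walk u v) (j : ℕ)
    (h1 : h u ≤ j) (h2 : j ≤ h v) : ∃ w, h w = j := by
  induction p with
  | nil => exact ⟨_, le_antisymm h1 h2⟩
  | @cons u u1 v e p ih =>
    by_cases hj : h u = j
    · exact ⟨u, hj⟩
    · have := hs u u1 e
      exact ih (by omega) h2

theorem ivt {V : Type} [Fintype V] [DecidableEq V] {G : SimpleGraph V} (hc : G.Connected) (f : V → ℕ) (w N : ℕ) (hw : 0 < w)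
    (hlip : ∀ u v, G.Adj u v → f v ≤ f u + w) (v0 : V) (h0 : f v0 = 0) (hN : (Finset.univ.image f).card ≤ N) (v : V) : f v < w * N := by
  have hs : ∀ u v, G.Adj u v → f v / w ≤ f u / w + 1 := by
    intro u v h
    rw [← Nat.add_div_right _ hw]
    exact Nat.div_le_div_right (hlip u v h)
  obtain ⟨p⟩ := hc.preconnected v0 v
  have : Finset.range (f v / w + 1) ⊆ (Finset.univ.image f).image (fun n => n / w) := by
    intro j hj
    rw [Finset.mem_range] at hj
    obtain ⟨u, hu⟩ := walk_ivt (fun v => f v / w) hs p j (by simp [h0]) (by omega)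
    rw [Finset.image_image]
    exact Finset.mem_image.2 ⟨u, Finset.mem_univ _, hu⟩
  have h1 := (Finset.card_le_card this).trans (Finset.card_image_le.trans hN)
  rw [Finset.card_range] at h1
  exact (Nat.div_lt_iff_lt_mul hw).1 (by omega) |>.trans_eq (mul_comm _ _)

theorem profile {V : Type} [Fintype V] [DecidableEq V] {G : SimpleGraph V} (hc : G.Connected) (ht : IsVertexTransitive G)
    {y : V} (Y : G.Walk y y) (hY : IsLongestCycle G Y) (ρ w : ℕ) (hρ : 0 < ρ) (hw : 0 < w) (hs : ∀ o, (sph G o ρ).card ≤ w)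
    (v0 : V) (h0 : ∀ v ∈ Y.support, v ∉ bl G v0 (ρ - 1)) : min ρ Y.length < w * ((3 * w) ^ w + 1) := by
  let f : V → ℕ := fun v => (Y.support.toFinset ∩ bl G v (ρ - 1)).card
  have lip : ∀ u v, G.Adj u v → f v ≤ f u + w := by
    intro u v h
    refine le_trans (Finset.card_le_card ?_) ((Finset.card_union_le (Y.support.toFinset ∩ bl G u (ρ - 1)) (sph G u ρ)).trans 
      (Nat.add_le_add_left (hs u) _))
    intro z hz
    rw [Finset.mem_inter, mem_bl] at hz
    rw [Finset.mem_union, Finset.mem_inter, mem_bl, mem_sph]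
    have h1 := hc.dist_triangle (u := u) (v := v) (w := z)
    rw [dist_eq_one_iff_adj.2 h] at h1
    by_cases hz' : G.dist u z ≤ ρ - 1
    · exact Or.inl ⟨hz.1, hz'⟩
    · right; omega
  have f0 : f v0 = 0 := by
    rw [Finset.card_eq_zero, Finset.eq_empty_iff_forall_notMem]
    intro v hv
    rw [Finset.mem_inter, List.mem_toFinset] at hv
    exact h0 v hv.1 hv.2
  have hne : Nonempty V := hc.nonempty
  have vals : (Finset.univ.image f).card ≤ (3 * w) ^ w + 1 := by
    choose g hg using fun v => ht v y
    have e := values_bound hY.2 (fun v => (Y.map (g v).toHom).toSubgraph.spanningCoe) (fun v => by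
      have := (walk_cycG _ (longest_map Y hY (g v)).1).1
      rwa [Walk.length_map] at this) (bl G y (ρ - 1)) (sph G y ρ) (by
      intro u hu v huv
      rw [mem_bl] at hu ⊢
      rw [mem_sph]
      have h1 := hc.dist_triangle (u := y) (v := u) (w := v)
      rw [dist_eq_one_iff_adj.2 huv] at h1
      omega)
    have ef : (fun v => ((Y.map (g v).toHom).toSubgraph.spanningCoe.support ∩ (bl G y (ρ - 1) : Set V)).ncard) = f := by
      funext v
      rw [(walk_cycG _ (longest_map Y hY (g v)).1).2, ← Finset.coe_inter, Set.ncard_coe_finset]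
      symm
      refine Finset.card_bij (fun z _ => g v z) ?_ (fun _ _ _ _ h => (g v).injective h) ?_
      · intro z hz
        rw [Finset.mem_inter, List.mem_toFinset, mem_bl] at hz ⊢
        refine ⟨?_, ?_⟩
        · rw [Walk.support_map]; exact List.mem_map.2 ⟨z, hz.1, rfl⟩
        · rw [← iso_dist hc (g v), hg] at hz; exact hz.2
      · intro z hz
        rw [Finset.mem_inter, List.mem_toFinset, mem_bl, Walk.support_map, List.mem_map] at hz
        obtain ⟨⟨a, ha, rfl⟩, hz⟩ := hz
        refine ⟨a, ?_, rfl⟩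
        rw [Finset.mem_inter, List.mem_toFinset, mem_bl, ← iso_dist hc (g v), hg]
        exact ⟨ha, hz⟩
    rw [ef] at e
    refine e.trans (Nat.add_le_add_right ?_ 1)
    exact (Nat.pow_le_pow_left (Nat.mul_le_mul_left 3 (hs y)) _).trans (Nat.pow_le_pow_right (by omega) (hs y))
  refine lt_of_le_of_lt ?_ (ivt hc f w _ hw lip v0 f0 vals y)
  have hinj := hY.1.getVert_injOn'
  rw [← Finset.card_range (min ρ Y.length)]
  refine Finset.card_le_card_of_injOn Y.getVert ?_ ?_
  · intro i hi
    rw [Finset.coe_range, Set.mem_Iio, lt_min_iff] at hi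
    rw [Finset.mem_coe, Finset.mem_inter, List.mem_toFinset, mem_bl]
    refine ⟨Y.getVert_mem_support i, (dist_le (Y.take i)).trans ?_⟩
    rw [Walk.take_length]; omega
  · intro i hi j hj h
    rw [Finset.coe_range, Set.mem_Iio, lt_min_iff] at hi hj
    exact hinj (by simp; omega) (by simp; omega) h

theorem key_bound {V : Type} [Fintype V] [DecidableEq V] {G : SimpleGraph V} (hc : G.Connected) (ht : IsVertexTransitive G)
    {x y : V} (X : G.Walk x x) (Y : G.Walk y y) (hX : IsLongestCycle G X) (hY : IsLongestCycle G Y) (T : Finset V) (t m : ℕ)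
    (hT : T.card ≤ t) (ht1 : 1 ≤ t) (hsep : ∀ a ∈ X.support, ∀ b ∈ Y.support, ∀ p : G.Walk a b, ∃ v ∈ p.support, v ∈ T)
    (hm : m = (40 * t) * ((3 * (40 * t)) ^ (40 * t) + 1)) : X.length < 100 * t ^ 2 * m := by
  by_contra hcon
  push Not at hcon
  have hXY : Y.length = X.length := le_antisymm (hX.2 _ _ hY.1) (hY.2 _ _ hX.1)
  have hm1 : 1 ≤ m := by
    rw [hm]; exact Nat.mul_pos (by omega) (by omega)
  obtain ⟨D, hD1, hD2, hD3⟩ := exists_side X Y T X.length (cycle_card X hX.1) ((cycle_card Y hY.1).trans hXY) hsep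
  have htm : 1 ≤ t * m := Nat.mul_pos ht1 hm1
  have hle1 : t ≤ t * m := Nat.le_mul_of_pos_right _ hm1
  have hle2 : t * m ≤ t ^ 2 * m := by rw [sq, mul_assoc]; exact Nat.le_mul_of_pos_left _ ht1
  have hLn : X.length ≤ Fintype.card V := by rw [← cycle_card X hX.1]; exact Finset.card_le_univ _
  obtain ⟨ρ, r1, r2, hs⟩ := small_sphere hc ht D T hD1 t m hT ht1 hm1 hD2 (by nlinarith)
  have hv : ∃ v, ∀ s ∈ T, 2 * m < G.dist s v := by
    by_contra hno
    push Not at hno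
    have h1 : (Finset.univ : Finset V) ⊆ T.biUnion fun s => bl G s (2 * m) := by
      intro v _
      obtain ⟨s, hs, h⟩ := hno v
      exact Finset.mem_biUnion.2 ⟨s, hs, mem_bl.2 h⟩
    have h2 := (Finset.card_le_card h1).trans Finset.card_biUnion_le
    have h3 := h2.trans (Finset.sum_le_sum fun s _ => (hs s).2)
    rw [Finset.sum_const, smul_eq_mul, Finset.card_univ] at h3
    have h4 : T.card * (40 * t * m) ≤ t * (40 * t * m) := Nat.mul_le_mul_right _ hT
    have h5 : t * (40 * t * m) = 40 * (t ^ 2 * m) := by ring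
    have h6 : 100 * t ^ 2 * m = 100 * (t ^ 2 * m) := by ring
    omega
  obtain ⟨v, hv⟩ := hv
  have near : ∀ {a b : V} (p : G.Walk a b), p.length ≤ ρ - 1 → ∀ u ∈ p.support, G.dist a u ≤ 2 * m := by
    intro a b p hp u hu
    have h1 := dist_le (p.takeUntil u hu)
    have h2 := p.length_takeUntil_le_length hu
    omega
  have key : (∀ a ∈ X.support, a ∉ bl G v (ρ - 1)) ∨ (∀ b ∈ Y.support, b ∉ bl G v (ρ - 1)) := by
    by_contra hno
    push Not at hno
    obtain ⟨⟨a, ha, ha'⟩, b, hb, hb'⟩ := hno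
    rw [mem_bl] at ha' hb'
    obtain ⟨p, hp⟩ := hc.exists_walk_length_eq_dist v a
    obtain ⟨q, hq⟩ := hc.exists_walk_length_eq_dist v b
    obtain ⟨s, hs1, hs2⟩ := hsep a ha b hb (p.reverse.append q)
    rw [Walk.mem_support_append_iff, Walk.support_reverse, List.mem_reverse] at hs1
    have h1 := hv s hs2
    rw [dist_comm] at h1
    rcases hs1 with h | h
    · have := near p (by omega) s h; omega
    · have := near q (by omega) s h; omega
  have hLm : m ≤ X.length := by nlinarith
  rcases key with h | h
  · have := profile hc ht X hX ρ (40 * t) (by omega) (by omega) (fun o => (hs o).1) v h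
    rw [← hm] at this
    omega
  · have := profile hc ht Y hY ρ (40 * t) (by omega) (by omega) (fun o => (hs o).1) v h
    rw [← hm] at this
    omega


theorem num_bound (k n L : ℕ) (hk : 1 ≤ k) (hn : n ≤ L ^ 2) 
    (hL : L < 100 * (5 * k ^ 2) ^ 2 * ((40 * (5 * k ^ 2)) * ((3 * (40 * (5 * k ^ 2))) ^ (40 * (5 * k ^ 2)) + 1))) :
    n ≤ 2 ^ (7200 * k ^ 3) := by
  obtain ⟨w, hw⟩ : ∃ w, w = 40 * (5 * k ^ 2) := ⟨_, rfl⟩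
  obtain ⟨B, hB⟩ : ∃ B, B = 3 * w := ⟨_, rfl⟩
  rw [← hw, ← hB] at hL
  have hk2 : 1 ≤ k ^ 2 := Nat.one_le_pow _ _ hk
  have hB1 : 1 ≤ B := by omega
  have h1 : 100 * (5 * k ^ 2) ^ 2 ≤ B ^ 2 := by
    have : 10 * (5 * k ^ 2) ≤ B := by omega
    calc 100 * (5 * k ^ 2) ^ 2 = (10 * (5 * k ^ 2)) ^ 2 := by ring
      _ ≤ B ^ 2 := Nat.pow_le_pow_left this 2
  have h2 : w * (B ^ w + 1) ≤ B ^ (w + 1) := by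
    have : 1 ≤ B ^ w := Nat.one_le_pow _ _ hB1
    calc w * (B ^ w + 1) ≤ w * (3 * B ^ w) := Nat.mul_le_mul_left _ (by omega)
      _ = B ^ (w + 1) := by rw [pow_succ]; nth_rewrite 3 [hB]; ring
  have h3 : L ≤ B ^ (w + 3) := by
    refine hL.le.trans ((Nat.mul_le_mul h1 h2).trans_eq ?_)
    rw [← pow_add]; congr 1; omega
  have hB2 : B ≤ 2 ^ (12 * k) := by
    have hk' : k ≤ 2 ^ k := Nat.lt_two_pow_self.le
    calc B = 600 * k ^ 2 := by rw [hB, hw]; ring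
      _ ≤ 2 ^ 10 * (2 ^ k) ^ 2 := Nat.mul_le_mul (by norm_num) (Nat.pow_le_pow_left hk' 2)
      _ = 2 ^ (10 + k * 2) := by rw [pow_add, pow_mul]
      _ ≤ 2 ^ (12 * k) := Nat.pow_le_pow_right (by norm_num) (by omega)
  calc n ≤ L ^ 2 := hn
    _ ≤ (B ^ (w + 3)) ^ 2 := Nat.pow_le_pow_left h3 2
    _ = B ^ ((w + 3) * 2) := by rw [pow_mul]
    _ ≤ B ^ (3 * w) := Nat.pow_le_pow_right hB1 (by omega)
    _ ≤ (2 ^ (12 * k)) ^ (3 * w) := Nat.pow_le_pow_left hB2 _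
    _ = 2 ^ (7200 * k ^ 3) := by rw [← pow_mul, hw]; congr 1; ring

theorem main_nat {V : Type} [Fintype V] [DecidableEq V] {G : SimpleGraph V} (hc : G.Connected) (ht : IsVertexTransitive G)
    {x y : V} (X : G.Walk x x) (Y : G.Walk y y) (hX : IsLongestCycle G X) (hY : IsLongestCycle G Y) :
    Fintype.card V ≤ 2 ^ (7200 * (X.support.toFinset ∩ Y.support.toFinset).card ^ 3) := by
  have hk := longest_meet hc ht X Y hX hY
  obtain ⟨T, hT, hsep⟩ := separator G X Y hX.1 hY.1 hX.2 hY.2 _ rfl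
  generalize (X.support.toFinset ∩ Y.support.toFinset).card = k at *
  have hk1 : 1 ≤ k := by omega
  exact num_bound k _ X.length hk1 (n_le_sq hc ht X hX) 
    (key_bound hc ht X Y hX hY T (5 * k ^ 2) _ (by nlinarith) (by nlinarith) hsep rfl)

theorem real_bound (n k : ℕ) (hn : 3 ≤ n) (h : n ≤ 2 ^ (7200 * k ^ 3)) (δ : ℝ) (hδ : δ = Real.log (Real.log 3)) (hpos : 0 < δ) :
    (δ / 7200) ^ ((1 : ℝ) / 3) * (Real.log n / Real.log (Real.log n)) ^ ((1 : ℝ) / 3) ≤ (k : ℝ) := by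
  have hn' : (3 : ℝ) ≤ n := by exact_mod_cast hn
  have l3 : 0 < Real.log 3 := Real.log_pos (by norm_num)
  have l1 : Real.log 3 ≤ Real.log n := Real.log_le_log (by norm_num) hn'
  have l2 : δ ≤ Real.log (Real.log n) := by rw [hδ]; exact Real.log_le_log l3 l1
  have l4 : Real.log n ≤ 7200 * (k : ℝ) ^ 3 := by
    have h' : (n : ℝ) ≤ 2 ^ (7200 * k ^ 3) := by exact_mod_cast h
    have := Real.log_le_log (by linarith) h'
    rw [Real.log_pow] at this
    push_cast at this
    have l2 : Real.log 2 ≤ 1 := by have := Real.log_two_lt_d9; linarith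
    have hp : (0 : ℝ) ≤ 7200 * (k : ℝ) ^ 3 := by positivity
    nlinarith
  have q0 : 0 ≤ Real.log n / Real.log (Real.log n) := div_nonneg (by linarith) (by linarith)
  rw [← Real.mul_rpow (by positivity) q0]
  have : δ / 7200 * (Real.log n / Real.log (Real.log n)) ≤ (k : ℝ) ^ (3 : ℕ) := by
    have e : Real.log n / Real.log (Real.log n) ≤ 7200 * (k : ℝ) ^ 3 / δ := 
      div_le_div₀ (by positivity) l4 hpos l2
    calc _ ≤ δ / 7200 * (7200 * (k : ℝ) ^ 3 / δ) := mul_le_mul_of_nonneg_left e (by positivity)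
      _ = _ := by field_simp
  refine (Real.rpow_le_rpow (mul_nonneg (by positivity) q0) this (by norm_num)).trans_eq ?_
  have := Real.pow_rpow_inv_natCast (x := (k : ℝ)) (n := 3) (by positivity) (by norm_num)
  rw [one_div]; exact_mod_cast this

theorem stmt_4 :
    ∃ c : ℝ, 0 < c ∧
      ∀ (V : Type) [Fintype V] [DecidableEq V] (G : SimpleGraph V),
        3 ≤ Fintype.card V → G.Connected → IsVertexTransitive G →
        ∀ {x y : V} (X : G.Walk x x) (Y : G.Walk y y),
          IsLongestCycle G X → IsLongestCycle G Y →
          c * (Real.log (Fintype.card V) / Real.log (Real.log (Fintype.card V))) ^ ((1 : ℝ) / 3) ≤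
            ((X.support.toFinset ∩ Y.support.toFinset).card : ℝ) := by
  have l3 : 1 < Real.log 3 := by
    rw [Real.lt_log_iff_exp_lt (by norm_num)]
    have := Real.exp_one_lt_d9
    linarith
  have hδ : 0 < Real.log (Real.log 3) := Real.log_pos l3
  refine ⟨(Real.log (Real.log 3) / 7200) ^ ((1 : ℝ) / 3), by positivity, ?_⟩
  intro V _ _ G hn hc ht x y X Y hX hY
  exact real_bound _ _ hn (main_nat hc ht X Y hX hY) _ rfl hδ
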